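/- arXiv:1109.4309 — 2 statements merged into one kernel-verified Lean document; each statement's English description precedes it below -/
import Mathlib

section
/- Let (A, d) be a differential graded commutative algebra over a field of characteristic 0, i a quasi-BV operator of even degree −2k with l = [i, d], and suppose [l, i] is also a quasi-BV operator. Define [a, b]_l = (−1)^{|a|}(l(ab) − l(a)b) − a l(b). Then (A, d, ·, [,]_l) is a Gerstenhaber algebra: [,]_l is a degree −2k+1 graded Lie bracket satisfying the graded Poisson (Leibniz) identity with respect to the product, d is a derivation of the bracket, and the DGLA (A[2k−1], d, [,]_l) is homotopy abelian. -/
/-!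
STATEMENT 12 (Theorem 4.3 of the paper):
Let `(A, d)` be a DGCA over a field of characteristic 0, `i` a quasi-BV operator of even
degree `-2k` with `l = [i, d]`, and suppose `[l, i]` is also quasi-BV.  Define
`[a, b]_l = (-1)^{|a|}(l(ab) - l(a)b) - a l(b)`.  Then `(A, d, ·, [,]_l)` is a Gerstenhaber
algebra: `[,]_l` is a degree `-2k+1` graded Lie bracket (graded antisymmetry and Jacobi in the
shifted degrees) satisfying the graded Poisson (Leibniz) identity with respect to the product,
`d` is a derivation of the bracket, and the DGLA `(A[2k-1], d, [,]_l)` is homotopy abelian.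
-/

variable (K : Type) [Field K] [CharZero K]

structure DGLAon (L : Type) [AddCommGroup L] [Module K L] where
  grading : ℤ → Submodule K L
  internal : DirectSum.IsInternal grading
  d : L →ₗ[K] L
  d_deg : ∀ i : ℤ, ∀ x ∈ grading i, d x ∈ grading (i + 1)
  d_sq : d ∘ₗ d = 0
  bracket : L →ₗ[K] L →ₗ[K] L
  bracket_deg : ∀ i j : ℤ, ∀ x ∈ grading i, ∀ y ∈ grading j, bracket x y ∈ grading (i + j)
  antisymm : ∀ i j : ℤ, ∀ x ∈ grading i, ∀ y ∈ grading j,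
    bracket x y = -(((i * j).negOnePow : ℤ) • bracket y x)
  jacobi : ∀ i j : ℤ, ∀ x ∈ grading i, ∀ y ∈ grading j, ∀ z : L,
    bracket x (bracket y z)
      = bracket (bracket x y) z + ((i * j).negOnePow : ℤ) • bracket y (bracket x z)
  leibniz : ∀ i : ℤ, ∀ x ∈ grading i, ∀ y : L,
    d (bracket x y) = bracket (d x) y + (i.negOnePow : ℤ) • bracket x (d y)

structure DGLA where
  L : Type
  [inst1 : AddCommGroup L]
  [inst2 : Module K L]
  str : DGLAon K L

attribute [instance] DGLA.inst1 DGLA.inst2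

structure DGLAHom (G H : DGLA K) where
  f : G.L →ₗ[K] H.L
  compat_d : ∀ x, f (G.str.d x) = H.str.d (f x)
  compat_br : ∀ x y, f (G.str.bracket x y) = H.str.bracket (f x) (f y)
  compat_gr : ∀ i : ℤ, ∀ x ∈ G.str.grading i, f x ∈ H.str.grading i

def IsQuasiIso {G H : DGLA K} (φ : DGLAHom K G H) : Prop :=
  (∀ x : G.L, G.str.d x = 0 → (∃ z, φ.f x = H.str.d z) → ∃ w, x = G.str.d w) ∧
  (∀ y : H.L, H.str.d y = 0 → ∃ x z, G.str.d x = 0 ∧ y = φ.f x + H.str.d z)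

def ZigZag : DGLA K → DGLA K → Prop :=
  Relation.EqvGen (fun G H => ∃ φ : DGLAHom K G H, IsQuasiIso K φ)

def HomotopyAbelian (G : DGLA K) : Prop :=
  ∃ H : DGLA K, (∀ x y, H.str.bracket x y = 0) ∧ ZigZag K G H

variable {K}
variable {A : Type} [Ring A] [Algebra K A]

def IsGradedComm (𝒜 : ℤ → Submodule K A) : Prop :=
  DirectSum.IsInternal 𝒜 ∧ (1 : A) ∈ 𝒜 0 ∧
    (∀ i j : ℤ, ∀ a ∈ 𝒜 i, ∀ b ∈ 𝒜 j, a * b ∈ 𝒜 (i + j)) ∧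
    (∀ i j : ℤ, ∀ a ∈ 𝒜 i, ∀ b ∈ 𝒜 j, a * b = ((i * j).negOnePow : ℤ) • (b * a))

def HasDeg (𝒜 : ℤ → Submodule K A) (f : A →ₗ[K] A) (r : ℤ) : Prop :=
  ∀ i : ℤ, ∀ a ∈ 𝒜 i, f a ∈ 𝒜 (i + r)

def IsGDer (𝒜 : ℤ → Submodule K A) (r : ℤ) (f : A →ₗ[K] A) : Prop :=
  ∀ i : ℤ, ∀ a ∈ 𝒜 i, ∀ b : A,
    f (a * b) = f a * b + ((r * i).negOnePow : ℤ) • (a * f b)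

def gcomm (r i : ℤ) (f : A →ₗ[K] A) (a : A) : A →ₗ[K] A :=
  f ∘ₗ LinearMap.mulLeft K a - ((r * i).negOnePow : ℤ) • (LinearMap.mulLeft K a ∘ₗ f)

def IsDiff (𝒜 : ℤ → Submodule K A) (r : ℤ) : ℕ → (A →ₗ[K] A) → Prop
  | 0, f => ∀ i : ℤ, ∀ a ∈ 𝒜 i, gcomm r i f a = 0
  | k + 1, f => ∀ i : ℤ, ∀ a ∈ 𝒜 i, IsDiff 𝒜 (r + i) k (gcomm r i f a)

def IsQuasiBV (𝒜 : ℤ → Submodule K A) (r : ℤ) (f : A →ₗ[K] A) : Prop :=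
  HasDeg 𝒜 f r ∧ IsDiff 𝒜 r 2 f ∧ f 1 = 0

/-- The Koszul bracket `[a, b]_l = (-1)^{|a|}(l(ab) - l(a)b) - a l(b)` generated by `l`
(`i` = degree of `a`). -/
def koszulBr (l : A →ₗ[K] A) (i : ℤ) (a b : A) : A :=
  (i.negOnePow : ℤ) • (l (a * b) - l a * b) - a * l b

section AuxPoly

theorem sgn_eq (n : ℤ) : ((n.negOnePow : ℤˣ) : ℤ) = if Even n then 1 else -1 := by
  split_ifs with h
  · rw [Int.negOnePow_even n h]; rfl
  · rw [Int.negOnePow_odd n (Int.not_even_iff_odd.mp h)]; rfl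

variable {F : Type} [Field F] {W : Type} [AddCommGroup W] [Module F W]

/-- Linear maps acting by scalars on the homogeneous components. -/
theorem exists_lin (gr : ℤ → Submodule F W) (h : DirectSum.IsInternal gr) (c : ℤ → F) :
    ∃ f : W →ₗ[F] W, ∀ m : ℤ, ∀ y ∈ gr m, f y = c m • y := by
  classical
  let _ := h.chooseDecomposition
  refine ⟨(DirectSum.toModule F ℤ W (fun m => c m • (gr m).subtype)) ∘ₗ
    (DirectSum.decomposeLinearEquiv gr).toLinearMap, fun m y hy => ?_⟩
  have := DirectSum.decompose_of_mem gr hy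
  have h3 : (DirectSum.decomposeLinearEquiv gr) y
      = DirectSum.lof F ℤ (fun i => gr i) m ⟨y, hy⟩ := this
  rw [LinearMap.comp_apply, LinearEquiv.coe_coe, h3, DirectSum.toModule_lof]
  rfl

theorem lin_ext (gr : ℤ → Submodule F W) (h : DirectSum.IsInternal gr) {V : Type}
    [AddCommGroup V] [Module F V] (f g : W →ₗ[F] V)
    (hfg : ∀ m : ℤ, ∀ y ∈ gr m, f y = g y) (x : W) : f x = g x := by
  have hx : x ∈ ⨆ i, gr i := by rw [h.submodule_iSup_eq_top]; trivial
  have hle : (⨆ i, gr i) ≤ LinearMap.eqLocus f g := iSup_le fun m y hy => hfg m y hy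
  exact hle hx

theorem internal_of_proj {M : Type} [AddCommGroup M] [Module F M] (gr : ℤ → Submodule F M)
    (π : ℤ → M →ₗ[F] M) (h1 : ∀ n, ∀ y ∈ gr n, π n y = y)
    (h2 : ∀ n m, m ≠ n → ∀ y ∈ gr m, π n y = 0) (htop : ⨆ i, gr i = ⊤) :
    DirectSum.IsInternal gr := by
  rw [DirectSum.isInternal_submodule_iff_iSupIndep_and_iSup_eq_top]
  refine ⟨?_, htop⟩
  intro n
  rw [Submodule.disjoint_def]
  intro x hx hx'
  have hle : (⨆ j, ⨆ (_ : j ≠ n), gr j) ≤ LinearMap.ker (π n) :=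
    iSup_le fun m => iSup_le fun hm y hy => h2 n m hm y hy
  rw [← h1 n x hx]
  exact hle hx'

noncomputable def pev (s : F) : (ℕ →₀ W) →ₗ[F] W := Finsupp.lsum F (fun n => s ^ n • LinearMap.id)

noncomputable def pext (β : W →ₗ[F] W →ₗ[F] W) : (ℕ →₀ W) →ₗ[F] (ℕ →₀ W) →ₗ[F] (ℕ →₀ W) :=
  Finsupp.lsum F (fun m => (LinearMap.flip (Finsupp.lsum F
    (fun n => (β.compr₂ (Finsupp.lsingle (m + n))).flip))))

noncomputable def pmap (f : W →ₗ[F] W) : (ℕ →₀ W) →ₗ[F] (ℕ →₀ W) :=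
  Finsupp.lsum F (fun n => Finsupp.lsingle n ∘ₗ f)

noncomputable def pshift : (ℕ →₀ W) →ₗ[F] (ℕ →₀ W) :=
  Finsupp.lsum F (fun n => Finsupp.lsingle (n + 1))

noncomputable def pder : (ℕ →₀ W) →ₗ[F] (ℕ →₀ W) :=
  Finsupp.lsum F (fun n => (n : F) • Finsupp.lsingle (n - 1))

noncomputable def pprim : (ℕ →₀ W) →ₗ[F] (ℕ →₀ W) :=
  Finsupp.lsum F (fun n => ((n : F) + 1)⁻¹ • Finsupp.lsingle (n + 1))

@[simp] theorem pev_single (s : F) (n : ℕ) (a : W) :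
    pev s (Finsupp.single n a) = s ^ n • a := by simp [pev]
@[simp] theorem pext_single (β : W →ₗ[F] W →ₗ[F] W) (m n : ℕ) (a b : W) :
    pext β (Finsupp.single m a) (Finsupp.single n b) = Finsupp.single (m + n) (β a b) := by
  simp [pext]
@[simp] theorem pmap_single (f : W →ₗ[F] W) (n : ℕ) (a : W) :
    pmap f (Finsupp.single n a) = Finsupp.single n (f a) := by simp [pmap]
@[simp] theorem pshift_single (n : ℕ) (a : W) :
    pshift (F := F) (Finsupp.single n a) = Finsupp.single (n + 1) a := by simp [pshift]
@[simp] theorem pder_single (n : ℕ) (a : W) :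
    pder (F := F) (Finsupp.single n a) = Finsupp.single (n - 1) ((n : F) • a) := by simp [pder]
@[simp] theorem pprim_single (n : ℕ) (a : W) :
    pprim (F := F) (Finsupp.single n a) = Finsupp.single (n + 1) (((n : F) + 1)⁻¹ • a) := by
  simp [pprim]

theorem pev_pext (s : F) (β : W →ₗ[F] W →ₗ[F] W) (p q : ℕ →₀ W) :
    pev s (pext β p q) = β (pev s p) (pev s q) := by
  induction p using Finsupp.induction_linear with
  | zero => simp
  | add f g hf hg => simp [hf, hg]
  | single m a =>
    induction q using Finsupp.induction_linear with
    | zero => simp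
    | add f g hf hg => simp [hf, hg]
    | single n b => simp [pow_add, smul_smul, mul_comm]

theorem pev_pmap (s : F) (f : W →ₗ[F] W) (p : ℕ →₀ W) :
    pev s (pmap f p) = f (pev s p) := by
  induction p using Finsupp.induction_linear with
  | zero => simp
  | add f g hf hg => simp [hf, hg]
  | single m a => simp

theorem pev_pshift (s : F) (p : ℕ →₀ W) : pev s (pshift (F := F) p) = s • pev s p := by
  induction p using Finsupp.induction_linear with
  | zero => simp
  | add f g hf hg => simp [hf, hg]
  | single m a => simp [smul_smul, pow_succ']

theorem pder_pshift (p : ℕ →₀ W) :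
    pder (F := F) (pshift (F := F) p) = p + pshift (F := F) (pder (F := F) p) := by
  induction p using Finsupp.induction_linear with
  | zero => simp
  | add f g hf hg => simp only [map_add, hf, hg]; abel
  | single m a =>
    rcases m with _ | m
    · simp
    · simp [add_smul, ← Finsupp.single_add]; abel_nf

theorem pder_pmap (f : W →ₗ[F] W) (p : ℕ →₀ W) :
    pder (F := F) (pmap f p) = pmap f (pder (F := F) p) := by
  induction p using Finsupp.induction_linear with
  | zero => simp
  | add f g hf hg => simp [hf, hg]
  | single m a => simp

theorem pprim_pmap (f : W →ₗ[F] W) (p : ℕ →₀ W) :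
    pprim (F := F) (pmap f p) = pmap f (pprim (F := F) p) := by
  induction p using Finsupp.induction_linear with
  | zero => simp
  | add f g hf hg => simp [hf, hg]
  | single m a => simp

theorem pmap_pmap (f g : W →ₗ[F] W) (p : ℕ →₀ W) :
    pmap f (pmap g p) = pmap (f ∘ₗ g) p := by
  induction p using Finsupp.induction_linear with
  | zero => simp
  | add f g hf hg => simp [hf, hg]
  | single m a => simp

theorem pder_pext (β : W →ₗ[F] W →ₗ[F] W) (p q : ℕ →₀ W) :
    pder (F := F) (pext β p q)
      = pext β (pder (F := F) p) q + pext β p (pder (F := F) q) := by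
  induction p using Finsupp.induction_linear with
  | zero => simp
  | add f g hf hg => simp only [map_add, LinearMap.add_apply, hf, hg]; abel
  | single m a =>
    induction q using Finsupp.induction_linear with
    | zero => simp
    | add f g hf hg => simp only [map_add, hf, hg]; abel
    | single n b =>
      rcases m with _ | m
      · simp
      · rcases n with _ | n
        · simp
        · have e1 : m + 1 + (n + 1) - 1 = m + n + 1 := by omega
          have e2 : m + 1 - 1 + (n + 1) = m + n + 1 := by omega
          have e3 : m + 1 + (n + 1 - 1) = m + n + 1 := by omega
          simp only [pext_single, pder_single, e1, e2, e3, map_smul, LinearMap.smul_apply,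
            ← Finsupp.single_add, ← add_smul]
          push_cast
          rfl

theorem pder_pprim [CharZero F] (p : ℕ →₀ W) : pder (F := F) (pprim (F := F) p) = p := by
  induction p using Finsupp.induction_linear with
  | zero => simp
  | add f g hf hg => simp [hf, hg]
  | single m a =>
    have : (m : F) + 1 ≠ 0 := Nat.cast_add_one_ne_zero m
    simp [smul_smul, this]

theorem pprim_pder [CharZero F] (p : ℕ →₀ W) :
    pprim (F := F) (pder (F := F) p) = p - Finsupp.single 0 (p 0) := by
  induction p using Finsupp.induction_linear with
  | zero => simp
  | add f g hf hg => simp only [map_add, hf, hg, Finsupp.add_apply, Finsupp.single_add]; abel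
  | single m a =>
    rcases m with _ | m
    · simp
    · have : (m : F) + 1 ≠ 0 := Nat.cast_add_one_ne_zero m
      simp [smul_smul, this]

theorem pev_inj [CharZero F] (p q : ℕ →₀ W) (h : ∀ s : F, pev s p = pev s q) : p = q := by
  rw [← sub_eq_zero]
  have h' : ∀ s : F, pev s (p - q) = 0 := fun s => by rw [map_sub, h, sub_self]
  generalize p - q = u at h'
  ext n
  rw [Finsupp.zero_apply, ← Module.forall_dual_apply_eq_zero_iff F]
  intro φ
  let P : Polynomial F := u.sum fun n a => Polynomial.monomial n (φ a)
  have hP : P = 0 := by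
    apply Polynomial.funext
    intro s
    have := congrArg φ (h' s)
    simp only [P, Finsupp.sum, Polynomial.eval_finsetSum, Polynomial.eval_monomial]
    simpa [pev, Finsupp.sum, mul_comm] using this
  have := congrArg (fun Q => Polynomial.coeff Q n) hP
  simp only [P, Finsupp.sum, Polynomial.finsetSum_coeff, Polynomial.coeff_monomial] at this
  by_cases hn : n ∈ u.support
  · simpa [hn] using this
  · simp [Finsupp.notMem_support_iff.mp hn]

noncomputable def psub (U : Submodule F W) : Submodule F (ℕ →₀ W) where
  carrier := {p | ∀ n, p n ∈ U}
  add_mem' ha hb n := U.add_mem (ha n) (hb n)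
  zero_mem' _ := U.zero_mem
  smul_mem' c _ hx n := U.smul_mem c (hx n)

theorem mem_psub {U : Submodule F W} {p : ℕ →₀ W} : p ∈ psub U ↔ ∀ n, p n ∈ U := Iff.rfl

theorem single_mem_psub {U : Submodule F W} {n : ℕ} {a : W} (h : a ∈ U) :
    Finsupp.single n a ∈ psub U := by
  intro m
  rw [Finsupp.single_apply]
  split_ifs
  · exact h
  · exact U.zero_mem

theorem lsum_mem {V : Type} [AddCommGroup V] [Module F V] {U : Submodule F W} {T : Submodule F V}
    (f : (ℕ →₀ W) →ₗ[F] V)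
    (hf : ∀ n, ∀ a ∈ U, f (Finsupp.single n a) ∈ T) {p : ℕ →₀ W} (hp : p ∈ psub U) :
    f p ∈ T := by
  rw [← p.sum_single, Finsupp.sum, map_sum]
  exact Submodule.sum_mem _ fun n _ => hf n _ (hp n)

theorem pev_mem {U : Submodule F W} (s : F) {p : ℕ →₀ W} (hp : p ∈ psub U) : pev s p ∈ U :=
  lsum_mem _ (fun n a ha => by rw [pev_single]; exact U.smul_mem _ ha) hp

theorem pshift_mem {U : Submodule F W} {p : ℕ →₀ W} (hp : p ∈ psub U) :
    pshift (F := F) p ∈ psub U :=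
  lsum_mem _ (fun n a ha => by rw [pshift_single]; exact single_mem_psub ha) hp

theorem pder_mem {U : Submodule F W} {p : ℕ →₀ W} (hp : p ∈ psub U) :
    pder (F := F) p ∈ psub U :=
  lsum_mem _ (fun n a ha => by
    rw [pder_single]; exact single_mem_psub (U.smul_mem _ ha)) hp

theorem pmap_mem {U V : Submodule F W} {f : W →ₗ[F] W} (hf : ∀ a ∈ U, f a ∈ V)
    {p : ℕ →₀ W} (hp : p ∈ psub U) : pmap f p ∈ psub V :=
  lsum_mem _ (fun n a ha => by rw [pmap_single]; exact single_mem_psub (hf a ha)) hp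

theorem pext_mem {U V T : Submodule F W} {β : W →ₗ[F] W →ₗ[F] W}
    (hβ : ∀ a ∈ U, ∀ b ∈ V, β a b ∈ T)
    {p q : ℕ →₀ W} (hp : p ∈ psub U) (hq : q ∈ psub V) : pext β p q ∈ psub T := by
  refine lsum_mem ((pext β).flip q) (fun n a ha => ?_) hp
  rw [LinearMap.flip_apply]
  exact lsum_mem (pext β (Finsupp.single n a)) (fun m b hb => by
    rw [pext_single]; exact single_mem_psub (hβ a ha b hb)) hq

theorem pair_internal (gr : ℤ → Submodule F W) (h : DirectSum.IsInternal gr) :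
    DirectSum.IsInternal (fun n => (psub (gr n)).prod (psub (gr (n - 1)))) := by
  choose π hπ using fun n : ℤ => exists_lin gr h (fun m => if m = n then 1 else 0)
  have hfix : ∀ n m : ℤ, ∀ p ∈ psub (gr m), pmap (π n) p = if m = n then p else 0 := by
    intro n m p hp
    split_ifs with hmn
    · have := lsum_mem (U := gr m) (T := LinearMap.ker (pmap (π n) - LinearMap.id))
        LinearMap.id (fun k a ha => by simp [hπ n m a ha, hmn]) hp
      simpa [sub_eq_zero] using this
    · have := lsum_mem (U := gr m) (T := LinearMap.ker (pmap (π n)))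
        LinearMap.id (fun k a ha => by simp [hπ n m a ha, hmn]) hp
      simpa using this
  refine internal_of_proj _ (fun n => LinearMap.prodMap (pmap (π n)) (pmap (π (n - 1)))) ?_ ?_ ?_
  · rintro n ⟨p, w⟩ ⟨hp, hw⟩
    simp only [LinearMap.prodMap_apply]
    rw [hfix n n p hp, hfix (n - 1) (n - 1) w hw]
    simp
  · rintro n m hmn ⟨p, w⟩ ⟨hp, hw⟩
    simp only [LinearMap.prodMap_apply]
    rw [hfix n m p hp, hfix (n - 1) (m - 1) w hw]
    have : m - 1 ≠ n - 1 := by omega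
    simp [hmn]
  · rw [eq_top_iff]
    rintro ⟨p, w⟩ -
    have hp : ∀ p : ℕ →₀ W, p ∈ psub (⨆ i, gr i) := fun p n => by
      rw [h.submodule_iSup_eq_top]; trivial
    have e : ((p, w) : (ℕ →₀ W) × (ℕ →₀ W))
        = LinearMap.inl F _ _ p + LinearMap.inr F _ _ w := by simp
    rw [e]
    refine Submodule.add_mem _ ?_ ?_
    · refine lsum_mem (U := ⨆ i, gr i) _ (fun n a ha => ?_) (hp p)
      have : (⨆ i, gr i) ≤ Submodule.comap (LinearMap.inl F _ _ ∘ₗ Finsupp.lsingle n)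
          (⨆ i, (psub (gr i)).prod (psub (gr (i - 1)))) := iSup_le fun i b hb => by
        refine Submodule.mem_iSup_of_mem i ⟨?_, ?_⟩
        · exact single_mem_psub hb
        · exact Submodule.zero_mem _
      exact this ha
    · refine lsum_mem (U := ⨆ i, gr i) _ (fun n a ha => ?_) (hp w)
      have : (⨆ i, gr i) ≤ Submodule.comap (LinearMap.inr F _ _ ∘ₗ Finsupp.lsingle n)
          (⨆ i, (psub (gr i)).prod (psub (gr (i - 1)))) := iSup_le fun i b hb => by
        refine Submodule.mem_iSup_of_mem (i + 1) ⟨?_, ?_⟩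
        · exact Submodule.zero_mem _
        · rw [add_sub_cancel_right]; exact single_mem_psub hb
      exact this ha

end AuxPoly
section AuxDGLA

/-- A graded complex with a degree `-1` product `R` whose `d`-coboundary is `B`, such that the
cubic compatibility between `R` and `B` holds. -/
structure HData (F : Type) [Field F] [CharZero F] (W : Type) [AddCommGroup W] [Module F W] where
  gr : ℤ → Submodule F W
  internal : DirectSum.IsInternal gr
  d : W →ₗ[F] W
  d_deg : ∀ i : ℤ, ∀ x ∈ gr i, d x ∈ gr (i + 1)
  d_sq : ∀ x, d (d x) = 0
  sg : W →ₗ[F] W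
  sg_spec : ∀ i : ℤ, ∀ x ∈ gr i, sg x = -((i.negOnePow : ℤ) • x)
  R : W →ₗ[F] W →ₗ[F] W
  B : W →ₗ[F] W →ₗ[F] W
  R_deg : ∀ i j : ℤ, ∀ x ∈ gr i, ∀ y ∈ gr j, R x y ∈ gr (i + j - 1)
  R_anti : ∀ i j : ℤ, ∀ x ∈ gr i, ∀ y ∈ gr j, R x y = -(((i * j).negOnePow : ℤ) • R y x)
  h3 : ∀ i : ℤ, ∀ x ∈ gr i, ∀ y,
    B x y = - R (d x) y - (i.negOnePow : ℤ) • R x (d y) - d (R x y)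
  h4 : ∀ i j : ℤ, ∀ x ∈ gr i, ∀ y ∈ gr j, ∀ z,
    R x (B y z) + (i.negOnePow : ℤ) • B x (R y z)
      = R (B x y) z + B (R x y) z
        + ((i * j).negOnePow : ℤ) • (R y (B x z) + (j.negOnePow : ℤ) • B y (R x z))

namespace HData

variable {F : Type} [Field F] [CharZero F] {W : Type} [AddCommGroup W] [Module F W]
variable (H : HData F W)

theorem B_deg (i j : ℤ) (x : W) (hx : x ∈ H.gr i) (y : W) (hy : y ∈ H.gr j) :
    H.B x y ∈ H.gr (i + j) := by
  rw [H.h3 i x hx y]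
  have h1 := H.R_deg _ _ _ (H.d_deg _ _ hx) _ hy
  have h2 := H.R_deg _ _ _ hx _ (H.d_deg _ _ hy)
  have h3 := H.d_deg _ _ (H.R_deg _ _ _ hx _ hy)
  rw [show i + 1 + j - 1 = i + j by ring] at h1
  rw [show i + (j + 1) - 1 = i + j by ring] at h2
  rw [show i + j - 1 + 1 = i + j by ring] at h3
  exact Submodule.sub_mem _ (Submodule.sub_mem _ (Submodule.neg_mem _ h1)
    (zsmul_mem h2 _)) h3

theorem B_leib (i : ℤ) (x : W) (hx : x ∈ H.gr i) (y : W) :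
    H.d (H.B x y) = H.B (H.d x) y + (i.negOnePow : ℤ) • H.B x (H.d y) := by
  rw [H.h3 i x hx y, H.h3 _ _ (H.d_deg _ _ hx) y, H.h3 i x hx (H.d y)]
  simp only [sgn_eq, Int.even_add_one]
  by_cases hi : Even i <;>
  simp only [hi, map_sub, map_neg, H.d_sq, map_zsmul, map_zero, LinearMap.zero_apply, if_true,
    if_false, not_true, not_false_eq_true] <;> module

theorem B_anti (i j : ℤ) (x : W) (hx : x ∈ H.gr i) (y : W) (hy : y ∈ H.gr j) :
    H.B x y = -(((i * j).negOnePow : ℤ) • H.B y x) := by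
  rw [H.h3 i x hx y, H.h3 j y hy x, H.R_anti _ _ _ (H.d_deg _ _ hx) _ hy,
    H.R_anti _ _ _ hx _ (H.d_deg _ _ hy), H.R_anti _ _ _ hx _ hy]
  simp only [sgn_eq, Int.even_add_one, Int.even_mul]
  by_cases hi : Even i <;> by_cases hj : Even j <;>
  simp [hi, hj] <;> module

theorem B_jac (i j : ℤ) (x : W) (hx : x ∈ H.gr i) (y : W) (hy : y ∈ H.gr j) (z : W) :
    H.B x (H.B y z) = H.B (H.B x y) z + ((i * j).negOnePow : ℤ) • H.B y (H.B x z) := by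
  have hdx := H.d_deg _ _ hx
  have hdy := H.d_deg _ _ hy
  have k0 := congrArg H.d (H.h4 i j x hx y hy z)
  have k1 := H.h4 _ j _ hdx y hy z
  have k2 := H.h4 i _ x hx _ hdy z
  have k3 := H.h4 i j x hx y hy (H.d z)
  have a1 := H.h3 i x hx (H.B y z)
  have a2 := H.h3 _ _ (H.B_deg _ _ _ hx _ hy) z
  have a3 := H.h3 j y hy (H.B x z)
  have b1 := H.B_leib i x hx (H.R y z)
  have b2 := H.B_leib _ _ (H.R_deg _ _ _ hx _ hy) z
  have b3 := H.B_leib j y hy (H.R x z)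
  have c1 := congrArg (H.B x) (H.h3 j y hy z)
  have c2 := congrArg (fun t => H.B t z) (H.h3 i x hx y)
  have c3 := congrArg (H.B y) (H.h3 i x hx z)
  have e1 := congrArg (H.R x) (H.B_leib j y hy z)
  have e2 := congrArg (fun t => H.R t z) (H.B_leib i x hx y)
  have e3 := congrArg (H.R y) (H.B_leib i x hx z)
  simp only [sgn_eq, Int.even_mul, Int.even_add, Int.even_sub_one, Int.not_even_one, map_add,
    map_sub, map_neg, map_zsmul, LinearMap.add_apply, LinearMap.sub_apply, LinearMap.neg_apply,
    LinearMap.smul_apply] at *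
  have two : ∀ u v : W, u + u = v + v → u = v := fun u v h => by
    replace h : (2 : F) • (u - v) = 0 := by
      rw [← sub_eq_zero] at h; rw [← h]; module
    rw [smul_eq_zero, sub_eq_zero] at h
    exact h.resolve_left two_ne_zero
  apply two
  clear two hx hy hdx hdy
  by_cases hi : Even i <;> by_cases hj : Even j <;>
  simp only [hi, hj, if_true, if_false, not_true, not_false_eq_true, true_or, or_true, or_false,
    false_or, true_iff, false_iff, iff_true, iff_false, one_smul, neg_smul, or_self, smul_neg,
    iff_self, LinearMap.neg_apply] at *
  all_goals grind

def toDGLAon : DGLAon F W where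
  grading := H.gr
  internal := H.internal
  d := H.d
  d_deg := H.d_deg
  d_sq := by ext x; exact H.d_sq x
  bracket := H.B
  bracket_deg := H.B_deg
  antisymm := H.B_anti
  jacobi := H.B_jac
  leibniz := H.B_leib

def abDGLAon : DGLAon F W where
  grading := H.gr
  internal := H.internal
  d := H.d
  d_deg := H.d_deg
  d_sq := by ext x; exact H.d_sq x
  bracket := 0
  bracket_deg := by intros; exact Submodule.zero_mem _
  antisymm := by intros; simp
  jacobi := by intros; simp
  leibniz := by intros; simp

noncomputable def pathBr :
    ((ℕ →₀ W) × (ℕ →₀ W)) →ₗ[F] ((ℕ →₀ W) × (ℕ →₀ W)) →ₗ[F] ((ℕ →₀ W) × (ℕ →₀ W)) :=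
  LinearMap.mk₂ F (fun x y => (pshift (F := F) (pext H.B x.1 y.1),
    - pext H.R x.1 y.1 + pshift (F := F) (pext H.B x.2 y.1)
      - pshift (F := F) (pext H.B (pmap H.sg x.1) y.2)))
    (by intro x x' y; ext1 <;> simp <;> abel)
    (by intro c x y; ext1 <;> simp [smul_sub])
    (by intro x y y'; ext1 <;> simp <;> abel)
    (by intro c x y; ext1 <;> simp [smul_sub])

noncomputable def pathD : ((ℕ →₀ W) × (ℕ →₀ W)) →ₗ[F] ((ℕ →₀ W) × (ℕ →₀ W)) :=
  LinearMap.prod (pmap H.d ∘ₗ LinearMap.fst F _ _)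
    (pder (F := F) ∘ₗ LinearMap.fst F _ _ - pmap H.d ∘ₗ LinearMap.snd F _ _)

theorem pathBr_apply (x y) : H.pathBr x y = (pshift (F := F) (pext H.B x.1 y.1),
    - pext H.R x.1 y.1 + pshift (F := F) (pext H.B x.2 y.1)
      - pshift (F := F) (pext H.B (pmap H.sg x.1) y.2)) := rfl

theorem pathD_apply (x) : H.pathD x = (pmap H.d x.1, pder (F := F) x.1 - pmap H.d x.2) := rfl

theorem sg_mem (i : ℤ) (x : W) (hx : x ∈ H.gr i) : H.sg x ∈ H.gr i := by
  rw [H.sg_spec i x hx]; exact Submodule.neg_mem _ (zsmul_mem hx _)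

noncomputable def pathDGLAon : DGLAon F ((ℕ →₀ W) × (ℕ →₀ W)) where
  grading := fun n => (psub (H.gr n)).prod (psub (H.gr (n - 1)))
  internal := pair_internal H.gr H.internal
  d := H.pathD
  d_deg := by
    rintro i ⟨p, w⟩ ⟨hp, hw⟩
    rw [pathD_apply]
    refine ⟨pmap_mem (H.d_deg i) hp, ?_⟩
    have h1 := pmap_mem (H.d_deg _) hw
    rw [sub_add_cancel] at h1
    simp only [add_sub_cancel_right]
    exact Submodule.sub_mem _ (pder_mem hp) h1
  d_sq := by
    have h : H.d ∘ₗ H.d = 0 := by ext x; exact H.d_sq x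
    have h0 : ∀ p : ℕ →₀ W, pmap (0 : W →ₗ[F] W) p = 0 := fun p => by
      have : pmap (0 : W →ₗ[F] W) = 0 := by
        apply Finsupp.lhom_ext
        intro n a
        simp
      rw [this, LinearMap.zero_apply]
    apply LinearMap.ext
    intro x
    simp only [LinearMap.comp_apply, pathD_apply, map_sub, pmap_pmap, h, h0, pder_pmap]
    ext1 <;> simp
  bracket := H.pathBr
  bracket_deg := by
    rintro i j ⟨p, w⟩ ⟨hp, hw⟩ ⟨q, v⟩ ⟨hq, hv⟩
    rw [pathBr_apply]
    refine ⟨pshift_mem (pext_mem (H.B_deg i j) hp hq), ?_⟩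
    refine Submodule.sub_mem _ (Submodule.add_mem _ (Submodule.neg_mem _ ?_) ?_) ?_
    · exact pext_mem (H.R_deg i j) hp hq
    · have := pshift_mem (pext_mem (H.B_deg _ _) hw hq)
      rwa [show i - 1 + j = i + j - 1 by ring] at this
    · have := pshift_mem (pext_mem (H.B_deg _ _) (pmap_mem (H.sg_mem i) hp) hv)
      rwa [show i + (j - 1) = i + j - 1 by ring] at this
  antisymm := by
    rintro i j ⟨p, w⟩ ⟨hp, hw⟩ ⟨q, v⟩ ⟨hq, hv⟩
    ext1
    · apply pev_inj (F := F)
      intro s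
      simp only [pathBr_apply, Prod.fst_neg, Prod.smul_fst, map_neg, map_zsmul, pev_pshift,
        pev_pext]
      rw [H.B_anti i j _ (pev_mem s hp) _ (pev_mem s hq)]
      module
    · apply pev_inj (F := F)
      intro s
      simp only [pathBr_apply, Prod.snd_neg, Prod.smul_snd, map_neg, map_zsmul, pev_pshift,
        pev_pext, map_add, map_sub, pev_pmap]
      rw [H.R_anti i j _ (pev_mem s hp) _ (pev_mem s hq),
        H.B_anti _ _ _ (pev_mem s hw) _ (pev_mem s hq), H.sg_spec i _ (pev_mem s hp),
        H.sg_spec j _ (pev_mem s hq), map_neg, map_neg, map_zsmul, map_zsmul,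
        LinearMap.neg_apply, LinearMap.neg_apply, LinearMap.smul_apply, LinearMap.smul_apply,
        H.B_anti _ _ _ (pev_mem s hp) _ (pev_mem s hv)]
      simp only [sgn_eq, Int.even_mul, Int.even_sub_one]
      by_cases hi : Even i <;> by_cases hj : Even j <;>
      simp [hi, hj] <;> module
  jacobi := by
    rintro i j ⟨p, w⟩ ⟨hp, hw⟩ ⟨q, v⟩ ⟨hq, hv⟩ ⟨u, t⟩
    ext1
    · apply pev_inj (F := F)
      intro s
      simp only [pathBr_apply, Prod.fst_add, Prod.smul_fst, map_add, map_zsmul, pev_pshift,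
        pev_pext, map_smul, LinearMap.smul_apply]
      rw [H.B_jac i j _ (pev_mem s hp) _ (pev_mem s hq)]
      module
    · apply pev_inj (F := F)
      intro s
      simp only [pathBr_apply, Prod.snd_add, Prod.smul_snd, map_add, map_sub, map_neg, map_zsmul,
        pev_pshift, pev_pext, map_smul, LinearMap.smul_apply, LinearMap.add_apply,
        LinearMap.sub_apply, LinearMap.neg_apply, pev_pmap]
      have P := pev_mem s hp
      have Q := pev_mem s hq
      have Wm := pev_mem s hw
      have V := pev_mem s hv
      have J1 := H.B_jac _ _ _ Wm _ Q (pev s u)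
      have J2 := H.B_jac _ _ _ P _ V (pev s u)
      have J3 := H.B_jac _ _ _ P _ Q (pev s t)
      have J4 := H.h4 _ _ _ P _ Q (pev s u)
      have S1 := H.sg_spec _ _ P
      have S2 := H.sg_spec _ _ Q
      have S3 := H.sg_spec _ _ (H.B_deg _ _ _ P _ Q)
      generalize pev s p = p at *
      generalize pev s q = q at *
      generalize pev s w = w at *
      generalize pev s v = v at *
      generalize pev s u = u at *
      generalize pev s t = t at *
      rw [S1, S2, S3]
      simp only [sgn_eq, Int.even_mul, Int.even_sub_one, Int.even_add] at *
      clear S1 S2 S3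
      by_cases hi : Even i <;> by_cases hj : Even j <;>
      simp [hi, hj] at J1 J2 J3 J4 ⊢
      all_goals (rw [J1, J2, J3, eq_sub_of_add_eq J4]; module)
  leibniz := by
    rintro i ⟨p, w⟩ ⟨hp, hw⟩ ⟨q, v⟩
    ext1
    · apply pev_inj (F := F)
      intro s
      simp only [pathBr_apply, pathD_apply, Prod.fst_add, Prod.smul_fst, map_add, map_zsmul,
        pev_pshift, pev_pext, pev_pmap, map_smul]
      rw [H.B_leib i _ (pev_mem s hp)]
      module
    · apply pev_inj (F := F)
      intro s
      simp only [pathBr_apply, pathD_apply, Prod.snd_add, Prod.smul_snd, map_add, map_sub,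
        map_neg, map_zsmul, pder_pshift, pder_pext, pev_pshift, pev_pext, map_smul,
        LinearMap.smul_apply, LinearMap.add_apply, LinearMap.sub_apply, LinearMap.neg_apply,
        pev_pmap]
      have P := pev_mem s hp
      have Wm := pev_mem s hw
      have J1 := H.B_leib _ _ Wm (pev s q)
      have J2 := H.B_leib _ _ P (pev s v)
      have J3 := H.h3 _ _ P (pev s q)
      have S1 := H.sg_spec _ _ P
      have S2 := H.sg_spec _ _ (H.d_deg _ _ P)
      rw [S1, S2]
      simp only [sgn_eq, Int.even_sub_one, Int.even_add_one] at *
      clear S1 S2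
      by_cases hi : Even i <;> 
      simp [hi] at J1 J2 J3 ⊢
      all_goals (rw [J1, J2, J3]; module)

theorem path_quasi (s : F) (S : DGLAon F W) (hg : S.grading = H.gr) (hd : S.d = H.d)
    (hb : ∀ x y, S.bracket x y = s • H.B x y) :
    ∃ φ : DGLAHom F ⟨_, H.pathDGLAon⟩ ⟨W, S⟩, IsQuasiIso F φ := by
  refine ⟨⟨pev s ∘ₗ LinearMap.fst F _ _, ?_, ?_, ?_⟩, ?_, ?_⟩
  · intro x
    change pev s (pmap H.d x.1) = S.d (pev s x.1)
    rw [hd, pev_pmap]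
  · intro x y
    change pev s (pshift (F := F) (pext H.B x.1 y.1)) = S.bracket (pev s x.1) (pev s y.1)
    rw [hb, pev_pshift, pev_pext]
  · rintro i ⟨p, w⟩ ⟨hp, hw⟩
    change pev s p ∈ S.grading i
    rw [hg]
    exact pev_mem s hp
  · rintro ⟨p, w⟩ hx ⟨z, hz⟩
    change pev s p = S.d z at hz
    rw [hd] at hz
    change H.pathD (p, w) = 0 at hx
    rw [pathD_apply, Prod.mk_eq_zero, sub_eq_zero] at hx
    obtain ⟨h1, h2⟩ := hx
    dsimp only at h1 h2
    refine ⟨(Finsupp.single 0 z + pprim (F := F) w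
      - Finsupp.single 0 (pev s (pprim (F := F) w)), 0), ?_⟩
    change (p, w) = H.pathD _
    rw [pathD_apply]
    ext1
    · simp only [map_add, map_sub, pmap_single]
      rw [← pev_pmap, ← pprim_pmap, ← h2, pprim_pder, ← hz, map_sub, pev_single]
      simp only [pow_zero, one_smul, Finsupp.single_sub]
      abel
    · simp [pder_pprim]
  · intro y hy
    change S.d y = 0 at hy
    rw [hd] at hy
    refine ⟨(Finsupp.single 0 y, 0), 0, ?_, ?_⟩
    · change H.pathD _ = 0
      rw [pathD_apply]
      simp [hy]
    · change y = pev s (Finsupp.single 0 y) + S.d 0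
      simp

theorem homotopyAbelian : HomotopyAbelian F ⟨W, H.toDGLAon⟩ := by
  refine ⟨⟨W, H.abDGLAon⟩, fun x y => rfl, ?_⟩
  have h1 := H.path_quasi 1 H.toDGLAon rfl rfl (fun x y => by rw [one_smul]; rfl)
  have h0 := H.path_quasi 0 H.abDGLAon rfl rfl (fun x y => by rw [zero_smul]; rfl)
  exact Relation.EqvGen.trans _ _ _ (Relation.EqvGen.symm _ _ (Relation.EqvGen.rel _ _ h1))
    (Relation.EqvGen.rel _ _ h0)

end HData

end AuxDGLA
section AuxA

variable {F : Type} [Field F] {C : Type} [Ring C] [Algebra F C]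

theorem seven (𝒜 : ℤ → Submodule F C) (hA : IsGradedComm 𝒜) (r : ℤ) (f : C →ₗ[F] C)
    (hf : IsQuasiBV 𝒜 r f) (i j : ℤ) (a : C) (ha : a ∈ 𝒜 i) (b : C) (hb : b ∈ 𝒜 j) (c : C) :
    f (a * (b * c)) - f a * (b * c) - ((r * i).negOnePow : ℤ) • (a * f (b * c))
      = (f (a * b) - f a * b - ((r * i).negOnePow : ℤ) • (a * f b)) * c
        + (((r + i) * j).negOnePow : ℤ) •
          (b * (f (a * c) - f a * c - ((r * i).negOnePow : ℤ) • (a * f c))) := by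
  obtain ⟨hinter, h1, hmul, hcomm⟩ := hA
  obtain ⟨hdeg, hdiff, hf1⟩ := hf
  generalize he1 : ((r * i).negOnePow : ℤ) = e1
  generalize he2 : (((r + i) * j).negOnePow : ℤ) = e2
  have T1 : f (a * b) - e1 • (a * f b) - e2 • (b * f a) ∈ 𝒜 (r + i + j) := by
    refine Submodule.sub_mem _ (Submodule.sub_mem _ ?_ (zsmul_mem ?_ _)) (zsmul_mem ?_ _)
    · have := hdeg _ _ (hmul _ _ _ ha _ hb)
      rwa [show i + j + r = r + i + j by ring] at this
    · have := hmul _ _ _ ha _ (hdeg _ _ hb)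
      rwa [show i + (j + r) = r + i + j by ring] at this
    · have := hmul _ _ _ hb _ (hdeg _ _ ha)
      rwa [show j + (i + r) = r + i + j by ring] at this
  have key := lin_ext 𝒜 hinter
    (gcomm (r + i) j (gcomm r i f a) b)
    (LinearMap.mulLeft F (f (a * b) - e1 • (a * f b) - e2 • (b * f a)))
    (by
      intro m c hc
      have h := LinearMap.congr_fun (hdiff i a ha j b hb m c hc) 1
      rw [LinearMap.mulLeft_apply, hcomm _ _ _ T1 _ hc]
      simp only [gcomm, LinearMap.sub_apply, LinearMap.comp_apply, LinearMap.smul_apply,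
        LinearMap.mulLeft_apply, mul_one, hf1, mul_zero, smul_zero, sub_zero, he1, he2,
        LinearMap.zero_apply, sub_eq_zero] at h ⊢
      exact h) c
  simp only [gcomm, LinearMap.sub_apply, LinearMap.comp_apply, LinearMap.smul_apply,
        LinearMap.mulLeft_apply, he1, he2] at key
  linear_combination (norm := skip) key
  simp only [mul_sub, sub_mul, smul_sub, mul_smul_comm, smul_mul_assoc, mul_assoc]
  abel

theorem seven_i
    (𝒜 : ℤ → Submodule F C)
    (hA : IsGradedComm 𝒜)
    (k : ℤ)
    (bi : C →ₗ[F] C)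
    (hbi : IsQuasiBV 𝒜 (-(2 * k)) bi)
    (i j : ℤ) (a : C) (ha : a ∈ 𝒜 i) (b : C) (hb : b ∈ 𝒜 j) (c : C) :
    bi (a * (b * c)) - bi a * (b * c) - (a * bi (b * c))
      = (bi (a * b) - bi a * b - (a * bi b)) * c
        + ((i * j).negOnePow : ℤ) • (b * (bi (a * c) - bi a * c - (a * bi c))) := by
  have h := seven 𝒜 hA _ bi hbi i j a ha b hb c
  simpa [sgn_eq, Int.even_mul, Int.even_add] using h

theorem seven_l
    (𝒜 : ℤ → Submodule F C)
    (hA : IsGradedComm 𝒜)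
    (d : C →ₗ[F] C)
    (hddeg : HasDeg 𝒜 d 1)
    (hder : IsGDer 𝒜 1 d)
    (k : ℤ)
    (bi : C →ₗ[F] C)
    (hbi : IsQuasiBV 𝒜 (-(2 * k)) bi)
    (l : C →ₗ[F] C)
    (hl : l = bi ∘ₗ d - d ∘ₗ bi)
    (i j : ℤ) (a : C) (ha : a ∈ 𝒜 i) (b : C) (hb : b ∈ 𝒜 j) (c : C) :
    l (a * (b * c)) - l a * (b * c) - (i.negOnePow : ℤ) • (a * l (b * c))
      = (l (a * b) - l a * b - (i.negOnePow : ℤ) • (a * l b)) * c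
        + (((i + 1) * j).negOnePow : ℤ) •
          (b * (l (a * c) - l a * c - (i.negOnePow : ℤ) • (a * l c))) := by
  have s1 := seven_i 𝒜 hA k bi hbi _ _ _ (hddeg _ _ ha) _ hb c
  have s2 := seven_i 𝒜 hA k bi hbi _ _ _ ha _ (hddeg _ _ hb) c
  have s3 := seven_i 𝒜 hA k bi hbi _ _ _ ha _ hb (d c)
  have s4 := congrArg d (seven_i 𝒜 hA k bi hbi _ _ _ ha _ hb c)
  have Da := hder _ _ ha
  have Db := hder _ _ hb
  have Dia := hder _ _ (hbi.1 _ _ ha)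
  have Dib := hder _ _ (hbi.1 _ _ hb)
  have Diab := hder _ _ (hbi.1 _ _ (hA.2.2.1 _ _ _ ha _ hb))
  subst hl
  linear_combination (norm := skip) s1 + (i.negOnePow : ℤ) • s2
    + ((i + j).negOnePow : ℤ) • s3 - s4
  simp only [sgn_eq, Int.even_mul, Int.even_add, even_neg, Int.not_even_one, even_two,
    true_or, iff_true, false_or, iff_false] at *
  clear s1 s2 s3 s4 ha hb hbi hA hder hddeg
  by_cases hi : Even i <;> by_cases hj : Even j <;>
  simp only [hi, hj, if_true, if_false, not_true, not_false_eq_true, true_or, or_true, or_false,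
    false_or, true_iff, false_iff, iff_true, iff_false, one_smul, neg_smul, or_self,
    iff_self, LinearMap.sub_apply, LinearMap.comp_apply, mul_sub, sub_mul, mul_add, add_mul,
    mul_assoc, map_sub, map_add, map_neg, neg_mul, mul_neg, Da, Db, Dia, Dib, Diab] at * <;>
  abel

theorem seven_m
    (𝒜 : ℤ → Submodule F C)
    (hA : IsGradedComm 𝒜)
    (k : ℤ)
    (bi : C →ₗ[F] C)
    (l : C →ₗ[F] C)
    (hli : IsQuasiBV 𝒜 (-(4 * k) + 1) (l ∘ₗ bi - bi ∘ₗ l))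
    (i j : ℤ) (a : C) (ha : a ∈ 𝒜 i) (b : C) (hb : b ∈ 𝒜 j) (c : C) :
    (l ∘ₗ bi - bi ∘ₗ l) (a * (b * c)) - (l ∘ₗ bi - bi ∘ₗ l) a * (b * c)
        - (i.negOnePow : ℤ) • (a * (l ∘ₗ bi - bi ∘ₗ l) (b * c))
      = ((l ∘ₗ bi - bi ∘ₗ l) (a * b) - (l ∘ₗ bi - bi ∘ₗ l) a * b
          - (i.negOnePow : ℤ) • (a * (l ∘ₗ bi - bi ∘ₗ l) b)) * c
        + (((i + 1) * j).negOnePow : ℤ) •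
          (b * ((l ∘ₗ bi - bi ∘ₗ l) (a * c) - (l ∘ₗ bi - bi ∘ₗ l) a * c
            - (i.negOnePow : ℤ) • (a * (l ∘ₗ bi - bi ∘ₗ l) c))) := by
  have h := seven 𝒜 hA _ _ hli i j a ha b hb c
  have e1 : (((-(4 * k) + 1) * i).negOnePow : ℤ) = i.negOnePow := by
    simp only [sgn_eq, Int.even_mul, Int.even_add, even_neg, show Even (4 : ℤ) from ⟨2, rfl⟩,
      Int.not_even_one, true_or, true_iff, false_or, false_iff, iff_false, not_true]
  have e2 : (((-(4 * k) + 1 + i) * j).negOnePow : ℤ) = ((i + 1) * j).negOnePow := by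
    simp only [sgn_eq, Int.even_mul, Int.even_add, even_neg, show Even (4 : ℤ) from ⟨2, rfl⟩,
      Int.not_even_one, true_or, true_iff, false_or, false_iff, iff_false, not_true]
  rw [e1, e2] at h
  exact h

theorem l_deg
    (𝒜 : ℤ → Submodule F C)
    (d : C →ₗ[F] C)
    (hddeg : HasDeg 𝒜 d 1)
    (k : ℤ)
    (bi : C →ₗ[F] C)
    (hbi : IsQuasiBV 𝒜 (-(2 * k)) bi)
    (l : C →ₗ[F] C)
    (hl : l = bi ∘ₗ d - d ∘ₗ bi): HasDeg 𝒜 l (-(2 * k) + 1) := by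
  intro i a ha
  subst hl
  have h1 := hbi.1 _ _ (hddeg _ _ ha)
  have h2 := hddeg _ _ (hbi.1 _ _ ha)
  rw [show i + 1 + -(2 * k) = i + (-(2 * k) + 1) by ring] at h1
  rw [show i + -(2 * k) + 1 = i + (-(2 * k) + 1) by ring] at h2
  exact Submodule.sub_mem _ h1 h2

def rr (f : C →ₗ[F] C) (a b : C) : C := f (a * b) - f a * b - a * f b
def ll (f : C →ₗ[F] C) (i : ℤ) (a b : C) : C :=
  f (a * b) - f a * b - (i.negOnePow : ℤ) • (a * f b)

theorem cubic
    (𝒜 : ℤ → Submodule F C)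
    (hA : IsGradedComm 𝒜)
    (d : C →ₗ[F] C)
    (hddeg : HasDeg 𝒜 d 1)
    (hder : IsGDer 𝒜 1 d)
    (k : ℤ)
    (bi : C →ₗ[F] C)
    (hbi : IsQuasiBV 𝒜 (-(2 * k)) bi)
    (l : C →ₗ[F] C)
    (hl : l = bi ∘ₗ d - d ∘ₗ bi)
    (hli : IsQuasiBV 𝒜 (-(4 * k) + 1) (l ∘ₗ bi - bi ∘ₗ l))
    (i j : ℤ) (a : C) (ha : a ∈ 𝒜 i) (b : C) (hb : b ∈ 𝒜 j) (c : C) :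
    ll l (i + j) (rr bi a b) c + ((i * j).negOnePow : ℤ) • ll l j b (rr bi a c)
      + ll l i a (rr bi b c) - rr bi (ll l i a b) c
      - (((i + 1) * j).negOnePow : ℤ) • rr bi b (ll l i a c)
      - (i.negOnePow : ℤ) • rr bi a (ll l j b c) = 0 := by
  have hldeg := l_deg 𝒜 d hddeg k bi hbi l hl
  have sm := seven_m 𝒜 hA k bi l hli i j a ha b hb c
  have s1 := congrArg l (seven_i 𝒜 hA k bi hbi _ _ _ ha _ hb c)
  have s2 := seven_l 𝒜 hA d hddeg hder k bi hbi l hl _ _ _ (hbi.1 _ _ ha) _ hb c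
  have s3 := seven_l 𝒜 hA d hddeg hder k bi hbi l hl _ _ _ ha _ (hbi.1 _ _ hb) c
  have s4 := seven_l 𝒜 hA d hddeg hder k bi hbi l hl _ _ _ ha _ hb (bi c)
  have s5 := congrArg bi (seven_l 𝒜 hA d hddeg hder k bi hbi l hl _ _ _ ha _ hb c)
  have s6 := seven_i 𝒜 hA k bi hbi _ _ _ (hldeg _ _ ha) _ hb c
  have s7 := seven_i 𝒜 hA k bi hbi _ _ _ ha _ (hldeg _ _ hb) c
  have s8 := seven_i 𝒜 hA k bi hbi _ _ _ ha _ hb (l c)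
  simp only [rr, ll]
  linear_combination (norm := skip) sm - s1 - s2 - s3 - s4 + s5 + s6 + (i.negOnePow : ℤ) • s7
    + ((i + j).negOnePow : ℤ) • s8
  clear sm s1 s2 s3 s4 s5 s6 s7 s8
  simp only [sgn_eq, Int.even_mul, Int.even_add, even_neg, Int.not_even_one, even_two,
    true_or, iff_true, false_or, iff_false]
  by_cases hi : Even i <;> by_cases hj : Even j <;>
  simp only [hi, hj, if_true, if_false, not_true, not_false_eq_true, true_or, or_true, or_false,
    false_or, true_iff, false_iff, iff_true, iff_false, one_smul, neg_smul, or_self,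
    iff_self, LinearMap.sub_apply, LinearMap.comp_apply, mul_sub, sub_mul, mul_add, add_mul,
    mul_assoc, map_sub, map_add, map_neg, neg_mul, mul_neg] <;>
  abel

theorem rr_smul (f : C →ₗ[F] C) (e : ℤ) (a b : C) : rr f a (e • b) = e • rr f a b := by
  simp only [rr, mul_smul_comm, map_zsmul, smul_sub]

theorem ll_smul (f : C →ₗ[F] C) (e i : ℤ) (a b : C) : ll f i a (e • b) = e • ll f i a b := by
  simp only [ll, mul_smul_comm, map_zsmul, smul_sub, smul_comm e]

end AuxA
section AuxFinal

variable {F : Type} [Field F] {C : Type} [Ring C] [Algebra F C]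

theorem shift_internal {W : Type} [AddCommGroup W] [Module F W] (gr : ℤ → Submodule F W)
    (h : DirectSum.IsInternal gr) (e : ℤ) : DirectSum.IsInternal (fun n => gr (n + e)) := by
  choose π hπ using fun n : ℤ => exists_lin gr h (fun m => if m = n + e then 1 else 0)
  refine internal_of_proj _ π ?_ ?_ ?_
  · intro n y hy
    rw [hπ n _ y hy]; simp
  · intro n m hmn y hy
    rw [hπ n _ y hy]; simp [hmn]
  · rw [← h.submodule_iSup_eq_top]
    exact (Equiv.addRight e).iSup_comp (g := gr)

theorem koszul_eq (l : C →ₗ[F] C) (i : ℤ) (a b : C) :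
    koszulBr l i a b = (i.negOnePow : ℤ) • ll l i a b := by
  simp only [koszulBr, ll, sgn_eq]
  by_cases hi : Even i <;> simp [hi] <;> abel

noncomputable def bigR (f sg : C →ₗ[F] C) : C →ₗ[F] C →ₗ[F] C :=
  LinearMap.mk₂ F (fun a b => f (sg a * b) - f (sg a) * b - sg a * f b)
    (by intros; simp only [map_add, add_mul]; abel)
    (by intros; simp [smul_sub])
    (by intros; simp only [map_add, mul_add]; abel)
    (by intros; simp [smul_sub])

noncomputable def bigB (f sg : C →ₗ[F] C) : C →ₗ[F] C →ₗ[F] C :=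
  LinearMap.mk₂ F (fun a b => f (sg a * b) - f (sg a) * b - a * f b)
    (by intros; simp only [map_add, add_mul]; abel)
    (by intros; simp [smul_sub])
    (by intros; simp only [map_add, mul_add]; abel)
    (by intros; simp [smul_sub])

theorem bigR_apply (f sg : C →ₗ[F] C) (i : ℤ) (a b : C) (h : sg a = (i.negOnePow : ℤ) • a) :
    bigR f sg a b = (i.negOnePow : ℤ) • rr f a b := by
  simp only [bigR, LinearMap.mk₂_apply, h, rr, sgn_eq]
  by_cases hi : Even i <;> simp [hi] <;> abel

theorem bigB_apply (f sg : C →ₗ[F] C) (i : ℤ) (a b : C) (h : sg a = (i.negOnePow : ℤ) • a) :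
    bigB f sg a b = (i.negOnePow : ℤ) • ll f i a b := by
  simp only [bigB, LinearMap.mk₂_apply, h, ll, sgn_eq]
  by_cases hi : Even i <;> simp [hi] <;> abel

theorem exists_HData [CharZero F] (𝒜 : ℤ → Submodule F C) (hA : IsGradedComm 𝒜)
    (d : C →ₗ[F] C) (hddeg : HasDeg 𝒜 d 1) (hder : IsGDer 𝒜 1 d) (hd2 : d ∘ₗ d = 0)
    (k : ℤ) (bi : C →ₗ[F] C) (hbi : IsQuasiBV 𝒜 (-(2 * k)) bi)
    (l : C →ₗ[F] C) (hl : l = bi ∘ₗ d - d ∘ₗ bi)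
    (hli : IsQuasiBV 𝒜 (-(4 * k) + 1) (l ∘ₗ bi - bi ∘ₗ l)) :
    ∃ H : HData F C, H.gr = (fun n => 𝒜 (n + (2 * k - 1))) ∧ H.d = d ∧
      (∀ i : ℤ, ∀ a ∈ 𝒜 i, ∀ b : C, H.B a b = koszulBr l i a b) := by
  obtain ⟨sg, hsg'⟩ := exists_lin 𝒜 hA.1 (fun m => (((m.negOnePow : ℤˣ) : ℤ) : F))
  have hsg : ∀ m : ℤ, ∀ y ∈ 𝒜 m, sg y = (m.negOnePow : ℤ) • y := fun m y hy => by
    rw [hsg' m y hy, Int.cast_smul_eq_zsmul]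
  have hldeg := l_deg 𝒜 d hddeg k bi hbi l hl
  have rdeg : ∀ i j : ℤ, ∀ x ∈ 𝒜 i, ∀ y ∈ 𝒜 j, rr bi x y ∈ 𝒜 (i + j - 2 * k) := by
    intro i j x hx y hy
    have h1 := hbi.1 _ _ (hA.2.2.1 _ _ _ hx _ hy)
    have h2 := hA.2.2.1 _ _ _ (hbi.1 _ _ hx) _ hy
    have h3 := hA.2.2.1 _ _ _ hx _ (hbi.1 _ _ hy)
    rw [show i + j + -(2 * k) = i + j - 2 * k by ring] at h1
    rw [show i + -(2 * k) + j = i + j - 2 * k by ring] at h2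
    rw [show i + (j + -(2 * k)) = i + j - 2 * k by ring] at h3
    exact Submodule.sub_mem _ (Submodule.sub_mem _ h1 h2) h3
  have ldeg : ∀ i j : ℤ, ∀ x ∈ 𝒜 i, ∀ y ∈ 𝒜 j, ll l i x y ∈ 𝒜 (i + j - 2 * k + 1) := by
    intro i j x hx y hy
    have h1 := hldeg _ _ (hA.2.2.1 _ _ _ hx _ hy)
    have h2 := hA.2.2.1 _ _ _ (hldeg _ _ hx) _ hy
    have h3 := hA.2.2.1 _ _ _ hx _ (hldeg _ _ hy)
    rw [show i + j + (-(2 * k) + 1) = i + j - 2 * k + 1 by ring] at h1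
    rw [show i + (-(2 * k) + 1) + j = i + j - 2 * k + 1 by ring] at h2
    rw [show i + (j + (-(2 * k) + 1)) = i + j - 2 * k + 1 by ring] at h3
    exact Submodule.sub_mem _ (Submodule.sub_mem _ h1 h2) (zsmul_mem h3 _)
  refine ⟨{ gr := fun n => 𝒜 (n + (2 * k - 1))
            internal := shift_internal 𝒜 hA.1 _
            d := d
            d_deg := ?_
            d_sq := fun x => LinearMap.congr_fun hd2 x
            sg := sg
            sg_spec := ?_
            R := bigR bi sg
            B := bigB l sg
            R_deg := ?_
            R_anti := ?_
            h3 := ?_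
            h4 := ?_ }, rfl, rfl, ?_⟩
  · intro i x hx
    have := hddeg _ _ hx
    rwa [show i + (2 * k - 1) + 1 = i + 1 + (2 * k - 1) by ring] at this
  · intro i x hx
    rw [hsg _ x hx]
    simp only [sgn_eq, Int.even_add, Int.even_sub_one, Int.even_mul, even_two]
    by_cases hi : Even i <;> simp [hi]
  · intro i j x hx y hy
    rw [bigR_apply bi sg _ x y (hsg _ x hx)]
    have := rdeg _ _ x hx y hy
    rw [show i + (2 * k - 1) + (j + (2 * k - 1)) - 2 * k = i + j - 1 + (2 * k - 1) by ring] at this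
    exact zsmul_mem this _
  · intro i j x hx y hy
    rw [bigR_apply bi sg _ x y (hsg _ x hx), bigR_apply bi sg _ y x (hsg _ y hy)]
    have c1 := hA.2.2.2 _ _ _ hx _ hy
    have c2 := hA.2.2.2 _ _ _ (hbi.1 _ _ hx) _ hy
    have c3 := hA.2.2.2 _ _ _ hx _ (hbi.1 _ _ hy)
    simp only [rr]
    rw [c1, c2, c3]
    simp only [sgn_eq, Int.even_add, Int.even_sub_one, Int.even_mul, even_two, even_neg]
    by_cases hi : Even i <;> by_cases hj : Even j <;> simp [hi, hj] <;> abel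
  · intro i x hx y
    rw [bigR_apply bi sg _ x _ (hsg _ x hx), bigR_apply bi sg _ x _ (hsg _ x hx),
      bigB_apply l sg _ x y (hsg _ x hx), bigR_apply bi sg _ (d x) _ (hsg _ _ (hddeg _ _ hx))]
    have Dx := hder _ _ hx
    have Dix := hder _ _ (hbi.1 _ _ hx)
    simp only [rr, ll]
    subst hl
    simp only [sgn_eq, Int.even_add, Int.even_sub_one, Int.even_mul, even_two, even_neg,
      Int.not_even_one] at Dx Dix ⊢
    by_cases hi : Even i <;> simp [hi, Dx, Dix, sub_mul, mul_sub, add_mul, mul_add] <;> abel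
  · intro i j x hx y hy z
    have E := cubic 𝒜 hA d hddeg hder k bi hbi l hl hli _ _ _ hx _ hy z
    have hR := fun t => bigR_apply bi sg _ _ t (hsg _ _ (ldeg _ _ _ hx _ hy))
    have hB := fun t => bigB_apply l sg _ _ t (hsg _ _ (rdeg _ _ _ hx _ hy))
    have l1 : ∀ t, ll l (i + (2 * k - 1) + (j + (2 * k - 1)) - 2 * k) (rr bi x y) t
        = ll l (i + (2 * k - 1) + (j + (2 * k - 1))) (rr bi x y) t := fun t => by
      simp only [ll, sgn_eq, Int.even_sub, Int.even_mul, even_two, true_or, iff_true]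
    simp only [bigR_apply bi sg _ x _ (hsg _ x hx), bigR_apply bi sg _ y _ (hsg _ y hy),
      bigB_apply l sg _ x _ (hsg _ x hx), bigB_apply l sg _ y _ (hsg _ y hy), map_zsmul,
      LinearMap.smul_apply, hR, hB, l1, rr_smul, ll_smul]
    have E' : ∀ e : ℤ, e • _ = e • _ := fun e => congrArg (fun t => e • t) E
    linear_combination (norm := skip) E' (j.negOnePow : ℤ)
    clear E E' hR hB l1
    generalize ll l _ x (rr bi y z) = t1
    generalize ll l _ y (rr bi x z) = t2
    generalize ll l _ (rr bi x y) z = t3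
    generalize rr bi x (ll l _ y z) = t4
    generalize rr bi y (ll l _ x z) = t5
    generalize rr bi (ll l _ x y) z = t6
    simp only [sgn_eq, Int.even_add, Int.even_sub, Int.even_mul, even_two, even_neg,
      Int.not_even_one]
    by_cases hi : Even i <;> by_cases hj : Even j <;> simp [hi, hj] <;> abel
  · intro i a ha b
    rw [koszul_eq]
    exact bigB_apply l sg i a b (hsg i a ha)

end AuxFinal
/-- `(A, d, ·, [,]_l)` is a Gerstenhaber algebra and the underlying DGLA
`(A[2k-1], d, [,]_l)` is homotopy abelian. -/
theorem gerstenhaber_and_homotopy_abelian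
    (𝒜 : ℤ → Submodule K A) (hA : IsGradedComm 𝒜)
    (d : A →ₗ[K] A) (hddeg : HasDeg 𝒜 d 1) (hder : IsGDer 𝒜 1 d) (hd2 : d ∘ₗ d = 0)
    (k : ℤ) (bi : A →ₗ[K] A) (hbi : IsQuasiBV 𝒜 (-(2 * k)) bi)
    (l : A →ₗ[K] A) (hl : l = bi ∘ₗ d - d ∘ₗ bi)
    (hli : IsQuasiBV 𝒜 (-(4 * k) + 1) (l ∘ₗ bi - bi ∘ₗ l)) :
    -- the graded Poisson (odd Leibniz) identity with respect to the product:
    (∀ i j m : ℤ, ∀ a ∈ 𝒜 i, ∀ b ∈ 𝒜 j, ∀ c ∈ 𝒜 m,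
      koszulBr l i a (b * c)
        = koszulBr l i a b * c
          + (((i + (-(2 * k) + 1)) * j).negOnePow : ℤ) • (b * koszulBr l i a c)) ∧
    -- DGLA structure on `A[2k-1]` (graded antisymmetry, Jacobi, Leibniz rule for `d`)
    -- and homotopy abelianity:
    (∃ S : DGLAon K A,
      S.grading = (fun n => 𝒜 (n + (2 * k - 1))) ∧
      S.d = d ∧
      (∀ i : ℤ, ∀ a ∈ 𝒜 i, ∀ b : A, S.bracket a b = koszulBr l i a b) ∧
      HomotopyAbelian K ⟨A, S⟩) := by
  refine ⟨?_, ?_⟩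
  · intro i j m a ha b hb c hc
    have h := seven_l 𝒜 hA d hddeg hder k bi hbi l hl i j a ha b hb c
    simp only [koszul_eq, ll]
    have h' : ∀ e : ℤ, e • _ = e • _ := fun e => congrArg (fun t => e • t) h
    rw [h' (i.negOnePow : ℤ)]
    have e2 : (((i + (-(2 * k) + 1)) * j).negOnePow : ℤ) = ((i + 1) * j).negOnePow := by
      simp only [sgn_eq, Int.even_mul, Int.even_add, even_neg, even_two,
        Int.not_even_one, true_or, true_iff]
    rw [e2, smul_add, smul_mul_assoc, mul_smul_comm, smul_comm]
  · obtain ⟨H, h1, h2, h3⟩ := exists_HData 𝒜 hA d hddeg hder hd2 k bi hbi l hl hli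
    exact ⟨H.toDGLAon, h1, h2, h3, H.homotopyAbelian⟩
end

section
/- Let π be a Poisson bivector field on a smooth manifold X (i.e. [π,π]_SN = 0). Then the Koszul bracket [α,β]_π = (−1)^{|α|}(l_π(α∧β) − l_π(α)∧β) − α∧l_π(β), where l_π = [i_π, d], makes the shifted de Rham complex (A_X[1], d, [,]_π) a differential graded Lie algebra that is homotopy abelian, i.e. quasi-isomorphic to an abelian DGLA; in particular it is formal. -/
/-!
STATEMENT 15 (Theorem 1.3 / Example 4.5 of the paper, Sharygin–Talalaev formality):
Let `π` be a Poisson bivector field on a smooth manifold `X` (`[π,π]_SN = 0`).  Then the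
Koszul bracket `[α,β]_π = (-1)^{|α|}(l_π(α∧β) - l_π(α)∧β) - α∧l_π(β)`, with `l_π = [i_π, d]`,
makes the shifted de Rham complex `(A_X[1], d, [,]_π)` a differential graded Lie algebra which
is homotopy abelian, i.e. quasi-isomorphic to an abelian DGLA; in particular it is formal.

Since differential forms on manifolds are not available in Mathlib, the de Rham algebra
`(A_X, d, ∧)` is modelled axiomatically as a graded-commutative unital DGCA `(A, 𝒜, d)` over
`ℝ`, and the interior product `i_π` by the Poisson bivector as a linear operator `iπ` of
degree `-2` which is a second-order differential operator with `iπ(1) = 0` (as the interior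
product by any bivector field is), and such that `[l_π, i_π] = 0` — by Cartan's formulas
`[l_π, i_π] = i_{[π,π]_SN}`, so this last condition is exactly the Poisson condition
`[π,π]_SN = 0`.
-/

variable (K : Type) [Field K] [CharZero K]

variable {K}
variable {A : Type} [Ring A] [Algebra K A]

set_option linter.unusedSimpArgs false

namespace KoszulFormality

lemma sg_ite (n : ℤ) : ((n.negOnePow : ℤˣ) : ℤ) = if Even n then 1 else -1 := by
  split_ifs with h
  · simp [Int.negOnePow_even n h]
  · simp [Int.negOnePow_odd n (Int.not_even_iff_odd.mp h)]

section basic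

variable {A : Type} [Ring A] [Algebra ℝ A]

/-- seven-term identity for an operator of degree `r` -/
def T3 (𝒜 : ℤ → Submodule ℝ A) (r : ℤ) (f : A →ₗ[ℝ] A) : Prop :=
  ∀ i j : ℤ, ∀ a ∈ 𝒜 i, ∀ b ∈ 𝒜 j, ∀ c : A,
    f (a * b * c) = ((r * i).negOnePow : ℤ) • (a * f (b * c))
      + (((r + i) * j).negOnePow : ℤ) • (b * f (a * c))
      - ((r * (i + j)).negOnePow : ℤ) • (a * b * f c)
      + f (a * b) * c - ((r * i).negOnePow : ℤ) • (a * f b * c) - f a * b * c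

lemma hom_ind {𝒜 : ℤ → Submodule ℝ A} (h : DirectSum.IsInternal 𝒜) {P : A → Prop}
    (h0 : P 0) (hadd : ∀ x y, P x → P y → P (x + y)) (hh : ∀ i, ∀ a ∈ 𝒜 i, P a) (x : A) : P x := by
  have hx : x ∈ iSup 𝒜 := by
    rw [h.submodule_iSup_eq_top]; trivial
  induction hx using Submodule.iSup_induction' with
  | mem i x hx => exact hh i x hx
  | zero => exact h0
  | add x y _ _ hx hy => exact hadd _ _ hx hy

lemma T3_of_diff {𝒜 : ℤ → Submodule ℝ A} (hA : IsGradedComm 𝒜) {r : ℤ} {f : A →ₗ[ℝ] A}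
    (hf : IsQuasiBV 𝒜 r f) : T3 𝒜 r f := by
  obtain ⟨hint, h1, hmul, hcomm⟩ := hA
  obtain ⟨hdeg, hdiff, hf1⟩ := hf
  intro i j a ha b hb c
  induction c using hom_ind hint with
  | h0 => simp
  | hadd x y hx hy =>
    simp only [mul_add, map_add, hx, hy, smul_add]
    abel
  | hh k c hc =>
    have h := congrArg (fun g : A →ₗ[ℝ] A => g 1) (hdiff i a ha j b hb k c hc)
    have hh1 : f (a * b) - ((r * i).negOnePow : ℤ) • (a * f b)
        - (((r + i) * j).negOnePow : ℤ) • (b * f a) ∈ 𝒜 (r + i + j) := by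
      refine sub_mem (sub_mem ?_ (zsmul_mem ?_ _)) (zsmul_mem ?_ _)
      · convert hdeg _ _ (hmul _ _ _ ha _ hb) using 2; ring
      · convert hmul _ _ _ ha _ (hdeg _ _ hb) using 2; ring
      · convert hmul _ _ _ hb _ (hdeg _ _ ha) using 2; ring
    have hc1 := hcomm _ _ _ hh1 _ hc
    have hc2 := hcomm _ _ _ ha _ hb
    have hc3 := hcomm _ _ _ (hdeg _ _ ha) _ hb
    simp only [gcomm, LinearMap.sub_apply, LinearMap.comp_apply, LinearMap.smul_apply,
      LinearMap.mulLeft_apply, mul_one, hf1, mul_zero, smul_zero, sub_zero, LinearMap.zero_apply] at h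
    simp only [sg_ite, Int.even_add, Int.even_mul] at *
    by_cases hi : Even i <;> by_cases hj : Even j <;> by_cases hk : Even k <;>
    by_cases hr : Even r <;>
    simp only [hi, hj, hk, hr, iff_true, iff_false, true_or, or_true, or_false, false_or, true_iff, false_iff, not_true, not_false_iff, if_true, if_false, one_smul, neg_smul] at * <;>
    simp only [hc2, hc3, sub_mul, neg_mul, mul_neg, mul_sub, neg_neg, sub_neg_eq_add, ← mul_assoc] at * <;>
    linear_combination (norm := noncomm_ring) h - hc1


lemma T3_comm {𝒜 : ℤ → Submodule ℝ A} (hA : IsGradedComm 𝒜)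
    (d : A →ₗ[ℝ] A) (hddeg : HasDeg 𝒜 d 1) (hder : IsGDer 𝒜 1 d)
    (f l : A →ₗ[ℝ] A) (hf : HasDeg 𝒜 f (-2)) (hT : T3 𝒜 (-2) f)
    (hl : ∀ x, l x = f (d x) - d (f x)) : T3 𝒜 (-1) l := by
  obtain ⟨hint, h1, hmul, hcomm⟩ := hA
  intro i j a ha b hb c
  have da := hder _ _ ha
  have db := hder _ _ hb
  have dfa := hder _ _ (hf _ _ ha)
  have dfb := hder _ _ (hf _ _ hb)
  have dfab := hder _ _ (hf _ _ (hmul _ _ _ ha _ hb))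
  have t0 := hT _ _ _ ha _ hb c
  have t1 := hT _ _ _ (hddeg _ _ ha) _ hb c
  have t2 := hT _ _ _ ha _ (hddeg _ _ hb) c
  have t3 := hT _ _ _ ha _ hb (d c)
  have e1 : ¬ Even (1 : ℤ) := by decide
  have e2 : Even (2 : ℤ) := by decide
  clear hint h1 hmul hcomm hT hder hddeg hf
  simp only [sg_ite, Int.even_add, Int.even_mul, even_neg, e1, e2] at *
  by_cases hi : Even i <;> by_cases hj : Even j <;>
    simp only [hi, hj, iff_true, iff_false, true_or, or_true, or_false, false_or, true_iff,
      false_iff, not_true, not_false_iff, if_true, if_false, one_smul, neg_smul, mul_assoc] at * <;>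
    simp only [hl, mul_assoc, da, db, dfa, dfb, dfab, t0, t1, t2, t3, map_add, map_sub, map_neg,
      mul_add, mul_sub, add_mul, sub_mul, neg_mul, mul_neg, neg_neg] <;>
    abel

structure BV (𝒜 : ℤ → Submodule ℝ A) (d l : A →ₗ[ℝ] A) : Prop where
  hA : IsGradedComm 𝒜
  hddeg : HasDeg 𝒜 d 1
  hder : IsGDer 𝒜 1 d
  hd2 : d ∘ₗ d = 0
  hl : HasDeg 𝒜 l (-1)
  hT : T3 𝒜 (-1) l
  hl2 : ∀ x, l (l x) = 0
  hdl : ∀ x, d (l x) = - l (d x)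

section BV

variable {𝒜 : ℤ → Submodule ℝ A} {d l : A →ₗ[ℝ] A}

lemma comm3 {i j : ℤ} {a b : A} (hA : IsGradedComm 𝒜) (ha : a ∈ 𝒜 i) (hb : b ∈ 𝒜 j) (x : A) :
    b * (a * x) = ((j * i).negOnePow : ℤ) • (a * (b * x)) := by
  rw [← mul_assoc, hA.2.2.2 _ _ _ hb _ ha, smul_mul_assoc, mul_assoc]

lemma br_poisson (h : BV 𝒜 d l) {i j : ℤ} {a b : A} (ha : a ∈ 𝒜 i) (hb : b ∈ 𝒜 j) (x : A) :
    koszulBr l i a (b * x) = koszulBr l i a b * x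
      + (((i + 1) * j).negOnePow : ℤ) • (b * koszulBr l i a x) := by
  have c1 := comm3 h.hA ha hb
  have c2 := comm3 h.hA (h.hl _ _ ha) hb
  have t := h.hT _ _ _ ha _ hb x
  have e1 : ¬ Even (1 : ℤ) := by decide
  simp only [koszulBr, sg_ite, Int.even_add, Int.even_mul, even_neg, e1] at *
  by_cases hi : Even i <;> by_cases hj : Even j <;>
    simp only [hi, hj, iff_true, iff_false, true_or, or_true, or_false, false_or, true_iff,
      false_iff, not_true, not_false_iff, if_true, if_false, one_smul, neg_smul, mul_assoc] at * <;>
    simp only [mul_assoc, t, c1, c2, map_add, map_sub, map_neg,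
      mul_add, mul_sub, add_mul, sub_mul, neg_mul, mul_neg, neg_neg] <;>
    abel

lemma br_l (h : BV 𝒜 d l) {i : ℤ} {a : A} (x : A) :
    l (koszulBr l i a x) = koszulBr l (i - 1) (l a) x - (i.negOnePow : ℤ) • koszulBr l i a (l x) := by
  have e1 : ¬ Even (1 : ℤ) := by decide
  simp only [koszulBr, sg_ite, Int.even_sub, e1]
  by_cases hi : Even i <;>
    simp [hi, h.hl2]

lemma br_d (h : BV 𝒜 d l) {i : ℤ} {a : A} (ha : a ∈ 𝒜 i) (x : A) :
    d (koszulBr l i a x) = koszulBr l (i + 1) (d a) x - (i.negOnePow : ℤ) • koszulBr l i a (d x) := by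
  have e1 : ¬ Even (1 : ℤ) := by decide
  have d1 := h.hder _ _ ha
  have d2 := h.hder _ _ (h.hl _ _ ha)
  simp only [koszulBr, sg_ite, Int.even_add, Int.even_mul, even_neg, e1] at *
  by_cases hi : Even i <;>
    simp [hi] at d1 d2 <;>
    simp [hi, h.hdl, d1, d2] <;> abel

lemma br_deg (h : BV 𝒜 d l) {i j : ℤ} {a b : A} (ha : a ∈ 𝒜 i) (hb : b ∈ 𝒜 j) :
    koszulBr l i a b ∈ 𝒜 (i + j - 1) := by
  have hmul := h.hA.2.2.1
  refine sub_mem (zsmul_mem (sub_mem ?_ ?_) _) ?_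
  · convert h.hl _ _ (hmul _ _ _ ha _ hb) using 2; ring
  · convert hmul _ _ _ (h.hl _ _ ha) _ hb using 2; ring
  · convert hmul _ _ _ ha _ (h.hl _ _ hb) using 2; ring

lemma br_symm (h : BV 𝒜 d l) {i j : ℤ} {a b : A} (ha : a ∈ 𝒜 i) (hb : b ∈ 𝒜 j) :
    koszulBr l i a b = -((((i - 1) * (j - 1)).negOnePow : ℤ) • koszulBr l j b a) := by
  have e1 : ¬ Even (1 : ℤ) := by decide
  have c1 := h.hA.2.2.2 _ _ _ hb _ ha
  have c2 := h.hA.2.2.2 _ _ _ hb _ (h.hl _ _ ha)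
  have c3 := h.hA.2.2.2 _ _ _ (h.hl _ _ hb) _ ha
  simp only [koszulBr, sg_ite, Int.even_add, Int.even_sub, Int.even_mul, even_neg, e1] at *
  by_cases hi : Even i <;> by_cases hj : Even j <;>
    simp only [hi, hj, iff_true, iff_false, true_or, or_true, or_false, false_or, true_iff,
      false_iff, not_true, not_false_iff, if_true, if_false, one_smul, neg_smul] at * <;>
    simp only [c1, c2, c3, map_neg] <;> abel

lemma br_jacobi (h : BV 𝒜 d l) {i j : ℤ} {a b : A} (ha : a ∈ 𝒜 i) (hb : b ∈ 𝒜 j) (x : A) :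
    koszulBr l i a (koszulBr l j b x) = koszulBr l (i + j - 1) (koszulBr l i a b) x
      + (((i - 1) * (j - 1)).negOnePow : ℤ) • koszulBr l j b (koszulBr l i a x) := by
  have e1 : ¬ Even (1 : ℤ) := by decide
  have p1 := br_poisson h ha hb
  have p2 := br_poisson h ha (h.hl _ _ hb)
  have p3 := br_poisson h (h.hl _ _ ha) hb
  have q1 : ∀ y, l (koszulBr l i a y) = _ := br_l h
  have hsub : ∀ y z, koszulBr l i a (y - z) = koszulBr l i a y - koszulBr l i a z := by
    intro y z; simp only [koszulBr, mul_sub, map_sub, smul_sub]; abel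
  have hneg : ∀ y, koszulBr l i a (-y) = - koszulBr l i a y := by
    intro y; simp only [koszulBr, mul_neg, map_neg, smul_neg, smul_sub]; abel
  have u1 : ∀ y, koszulBr l j b y = (j.negOnePow : ℤ) • (l (b * y) - l b * y) - b * l y :=
    fun _ => rfl
  have u2 : koszulBr l (i + j - 1) (koszulBr l i a b) x = ((i + j - 1).negOnePow : ℤ) •
    (l (koszulBr l i a b * x) - l (koszulBr l i a b) * x) - koszulBr l i a b * l x := rfl
  have q2 := q1 (b * x)
  rw [u2, u1 x, u1 (koszulBr l i a x)]
  have e3 : i + -1 = i - 1 := rfl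
  rw [e3] at p3
  rw [p1, p3] at q2
  generalize koszulBr l i a = D at *
  generalize koszulBr l (i - 1) (l a) = D' at *
  have q3 := congrArg (fun z => z * x) (q1 b)
  have q4 := congrArg (fun z => b * z) (q1 x)
  simp only [sg_ite, Int.even_add, Int.even_sub, Int.even_mul, even_neg, e1] at *
  by_cases hi : Even i <;> by_cases hj : Even j <;>
    simp only [hi, hj, iff_true, iff_false, true_or, or_true, or_false, false_or, true_iff,
      false_iff, not_true, not_false_iff, if_true, if_false, one_smul, neg_smul, hsub, hneg, p1, p2, map_add, map_sub, map_neg] at *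
  · linear_combination (norm := noncomm_ring) q2 - q3 - q4
  · linear_combination (norm := noncomm_ring) - q2 + q3 + q4
  · linear_combination (norm := noncomm_ring) - q2 + q3 + q4
  · linear_combination (norm := noncomm_ring) q2 - q3 + q4

end BV

lemma exists_piecewise {𝒜 : ℤ → Submodule ℝ A} (hint : DirectSum.IsInternal 𝒜) (s : ℤ → ℤ) :
    ∃ σ : A →ₗ[ℝ] A, ∀ i, ∀ a ∈ 𝒜 i, σ a = s i • a := by
  let e := LinearEquiv.ofBijective (DirectSum.coeLinearMap 𝒜) hint
  refine ⟨(DirectSum.toModule ℝ ℤ A (fun i => s i • (𝒜 i).subtype)) ∘ₗ e.symm.toLinearMap, ?_⟩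
  intro i a ha
  have : e.symm a = DirectSum.lof ℝ ℤ (fun i => 𝒜 i) i ⟨a, ha⟩ := by
    rw [LinearEquiv.symm_apply_eq]
    exact (DirectSum.coeLinearMap_lof 𝒜 i ⟨a, ha⟩).symm
  simp [this]

lemma internal_of_proj {M : Type} [AddCommGroup M] [Module ℝ M] {𝒜 : ℤ → Submodule ℝ M}
    (hp : ∀ n, ∃ p : M →ₗ[ℝ] M, (∀ x ∈ 𝒜 n, p x = x) ∧ ∀ m ≠ n, ∀ x ∈ 𝒜 m, p x = 0)
    (htop : iSup 𝒜 = ⊤) : DirectSum.IsInternal 𝒜 := by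
  rw [DirectSum.isInternal_submodule_iff_iSupIndep_and_iSup_eq_top]
  refine ⟨?_, htop⟩
  intro n
  obtain ⟨p, hp1, hp2⟩ := hp n
  rw [Submodule.disjoint_def]
  intro x hx hx'
  have : (⨆ j, ⨆ (_ : j ≠ n), 𝒜 j) ≤ LinearMap.ker p := by
    refine iSup₂_le ?_
    intro m hm y hy
    exact hp2 m hm y hy
  rw [← hp1 x hx]
  exact this hx'

lemma exists_sigma {𝒜 : ℤ → Submodule ℝ A} (hA : IsGradedComm 𝒜) :
    ∃ σ : A →ₐ[ℝ] A, ∀ i, ∀ a ∈ 𝒜 i, σ a = (i.negOnePow : ℤ) • a := by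
  obtain ⟨σ, hσ⟩ := exists_piecewise hA.1 (fun i => (i.negOnePow : ℤ))
  refine ⟨AlgHom.ofLinearMap σ ?_ ?_, hσ⟩
  · rw [hσ 0 1 hA.2.1]; simp
  · intro x y
    induction x using hom_ind hA.1 with
    | h0 => simp
    | hadd x y hx hy => simp only [add_mul, map_add, hx, hy]
    | hh i a ha =>
      induction y using hom_ind hA.1 with
      | h0 => simp
      | hadd x y hx hy => simp only [mul_add, map_add, hx, hy]
      | hh j b hb =>
        rw [hσ _ _ ha, hσ _ _ hb, hσ _ _ (hA.2.2.1 _ _ _ ha _ hb), smul_mul_smul_comm]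
        simp [Int.negOnePow_add]

lemma exists_dgla {𝒜 : ℤ → Submodule ℝ A} {d l : A →ₗ[ℝ] A} (h : BV 𝒜 d l) :
    ∃ S : DGLAon ℝ A, S.grading = (fun n => 𝒜 (n + 1)) ∧ S.d = d ∧
      (∀ i : ℤ, ∀ a ∈ 𝒜 i, ∀ b : A, S.bracket a b = koszulBr l i a b) := by
  obtain ⟨σ, hσ⟩ := exists_sigma h.hA
  let br : A →ₗ[ℝ] A →ₗ[ℝ] A := LinearMap.mk₂ ℝ
    (fun a b => l (σ a * b) - l (σ a) * b - a * l b)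
    (by intro x y z; simp only [map_add, add_mul]; abel)
    (by intro c x y; simp only [map_smul, smul_mul_assoc, smul_sub])
    (by intro x y z; simp only [map_add, mul_add]; abel)
    (by intro c x y; simp only [map_smul, mul_smul_comm, smul_sub])
  have hbr : ∀ i : ℤ, ∀ a ∈ 𝒜 i, ∀ b : A, br a b = koszulBr l i a b := by
    intro i a ha b
    simp only [br, LinearMap.mk₂_apply, hσ i a ha, koszulBr, smul_mul_assoc, map_zsmul, smul_sub]
  have hint : DirectSum.IsInternal (fun n => 𝒜 (n + 1)) := by
    refine internal_of_proj ?_ ?_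
    · intro n
      obtain ⟨p, hp⟩ := exists_piecewise h.hA.1 (fun i => if i = n + 1 then 1 else 0)
      refine ⟨p, ?_, ?_⟩
      · intro x hx; simp [hp _ _ hx]
      · intro m hm x hx; simp [hp _ _ hx, hm]
    · rw [← h.hA.1.submodule_iSup_eq_top]
      exact (Equiv.addRight (1 : ℤ)).iSup_comp (g := 𝒜)
  refine ⟨{ grading := fun n => 𝒜 (n + 1), internal := hint, d := d,
            d_deg := fun i x hx => h.hddeg _ _ hx
            d_sq := h.hd2, bracket := br, bracket_deg := ?_, antisymm := ?_, jacobi := ?_,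
            leibniz := ?_ }, rfl, rfl, hbr⟩
  · intro i j x hx y hy
    rw [hbr _ _ hx]
    convert br_deg h hx hy using 2; ring
  · intro i j x hx y hy
    rw [hbr _ _ hx, hbr _ _ hy, br_symm h hx hy]
    simp
  · intro i j x hx y hy z
    rw [hbr _ _ hy, hbr _ _ hx, hbr _ _ hx, hbr _ _ (br_deg h hx hy), hbr _ _ hx, hbr _ _ hy,
      br_jacobi h hx hy]
    simp
  · intro i x hx y
    rw [hbr _ _ hx, hbr _ _ hx, hbr _ _ (h.hddeg _ _ hx), br_d h hx]
    simp [Int.negOnePow_succ, sub_eq_add_neg]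

lemma exists_hom {B : Type} [Ring B] [Algebra ℝ B] {𝒜 : ℤ → Submodule ℝ A}
    {ℬ : ℤ → Submodule ℝ B} (hB : IsGradedComm ℬ) {d l : A →ₗ[ℝ] A} {dB lB : B →ₗ[ℝ] B}
    (S : DGLAon ℝ A) (hS : S.grading = (fun n => 𝒜 (n + 1)) ∧ S.d = d ∧
      (∀ i : ℤ, ∀ a ∈ 𝒜 i, ∀ b : A, S.bracket a b = koszulBr l i a b))
    (SB : DGLAon ℝ B) (hSB : SB.grading = (fun n => ℬ (n + 1)) ∧ SB.d = dB ∧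
      (∀ i : ℤ, ∀ a ∈ ℬ i, ∀ b : B, SB.bracket a b = koszulBr lB i a b))
    (f : B →ₐ[ℝ] A) (hfg : ∀ i, ∀ x ∈ ℬ i, f x ∈ 𝒜 i)
    (hfd : ∀ x, f (dB x) = d (f x)) (hfl : ∀ x, f (lB x) = l (f x))
    (h1 : ∀ x, dB x = 0 → (∃ z, f x = d z) → ∃ w, x = dB w)
    (h2 : ∀ y, d y = 0 → ∃ x, dB x = 0 ∧ y = f x) :
    ∃ φ : DGLAHom ℝ ⟨B, SB⟩ ⟨A, S⟩, IsQuasiIso ℝ φ := by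
  obtain ⟨g1, g2, g3⟩ := hS
  obtain ⟨k1, k2, k3⟩ := hSB
  refine ⟨{ f := f.toLinearMap, compat_d := ?_, compat_br := ?_, compat_gr := ?_ }, ?_, ?_⟩
  · intro x
    simp only [g2, k2, AlgHom.toLinearMap_apply, hfd]
  · intro x y
    simp only [AlgHom.toLinearMap_apply]
    induction x using hom_ind hB.1 with
    | h0 => simp
    | hadd x y hx hy => simp only [map_add, LinearMap.add_apply, hx, hy]
    | hh i a ha =>
      rw [k3 _ _ ha, g3 _ _ (hfg _ _ ha)]
      simp [koszulBr, hfl]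
  · intro i x hx
    simp only [g1, k1] at hx ⊢
    exact hfg _ _ hx
  · intro x hx hz
    simp only [g2, k2] at *
    exact h1 x hx hz
  · intro y hy
    simp only [g2, k2] at *
    obtain ⟨x, hx, hxy⟩ := h2 y hy
    exact ⟨x, 0, hx, by rw [map_zero, add_zero]; exact hxy⟩

end basic

section pair

variable {R : Type} [Ring R] [Algebra ℝ R]

/-- `R ⊕ ds R`; the element `(p, q)` is `p + ds q`. -/
def DS (_σ : R →ₐ[ℝ] R) : Type := R × R

variable (σ : R →ₐ[ℝ] R)

/-- the element `p + ds q` -/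
def DS.of (p q : R) : DS σ := (p, q)

instance : AddCommGroup (DS σ) := inferInstanceAs (AddCommGroup (R × R))
instance : Module ℝ (DS σ) := inferInstanceAs (Module ℝ (R × R))
instance : Mul (DS σ) := ⟨fun x y => (x.1 * y.1, x.2 * y.1 + σ x.1 * y.2)⟩
instance : One (DS σ) := ⟨((1 : R), (0 : R))⟩

variable {σ}

@[ext] lemma DS.ext {x y : DS σ} (h1 : x.1 = y.1) (h2 : x.2 = y.2) : x = y := Prod.ext h1 h2

@[simp] lemma DS.of_fst (p q : R) : (DS.of σ p q).1 = p := rfl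
@[simp] lemma DS.of_snd (p q : R) : (DS.of σ p q).2 = q := rfl
@[simp] lemma DS.add_fst (x y : DS σ) : (x + y).1 = x.1 + y.1 := rfl
@[simp] lemma DS.add_snd (x y : DS σ) : (x + y).2 = x.2 + y.2 := rfl
@[simp] lemma DS.sub_fst (x y : DS σ) : (x - y).1 = x.1 - y.1 := rfl
@[simp] lemma DS.sub_snd (x y : DS σ) : (x - y).2 = x.2 - y.2 := rfl
@[simp] lemma DS.neg_fst (x : DS σ) : (-x).1 = -x.1 := rfl
@[simp] lemma DS.neg_snd (x : DS σ) : (-x).2 = -x.2 := rfl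
@[simp] lemma DS.zero_fst : (0 : DS σ).1 = 0 := rfl
@[simp] lemma DS.zero_snd : (0 : DS σ).2 = 0 := rfl
@[simp] lemma DS.smul_fst (c : ℝ) (x : DS σ) : (c • x).1 = c • x.1 := rfl
@[simp] lemma DS.smul_snd (c : ℝ) (x : DS σ) : (c • x).2 = c • x.2 := rfl
@[simp] lemma DS.one_fst : (1 : DS σ).1 = 1 := rfl
@[simp] lemma DS.one_snd : (1 : DS σ).2 = 0 := rfl
@[simp] lemma DS.mul_fst (x y : DS σ) : (x * y).1 = x.1 * y.1 := rfl
@[simp] lemma DS.mul_snd (x y : DS σ) : (x * y).2 = x.2 * y.1 + σ x.1 * y.2 := rfl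

instance : Ring (DS σ) :=
  { (inferInstance : AddCommGroup (DS σ)) with
    mul := (· * ·)
    one := 1
    mul_assoc := by intro x y z; ext <;> simp <;> noncomm_ring
    one_mul := by intro x; ext <;> simp
    mul_one := by intro x; ext <;> simp
    left_distrib := by intro x y z; ext <;> simp <;> noncomm_ring
    right_distrib := by intro x y z; ext <;> simp <;> noncomm_ring
    zero_mul := by intro x; ext <;> simp
    mul_zero := by intro x; ext <;> simp }

instance : Algebra ℝ (DS σ) :=
  Algebra.ofModule (by intro c x y; ext <;> simp) (by intro c x y; ext <;> simp)

@[simp] lemma DS.zsmul_fst (c : ℤ) (x : DS σ) : (c • x).1 = c • x.1 := rfl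
@[simp] lemma DS.zsmul_snd (c : ℤ) (x : DS σ) : (c • x).2 = c • x.2 := rfl

/-- the grading of `R ⊕ ds R` -/
def DS.gr (σ : R →ₐ[ℝ] R) (𝒜 : ℤ → Submodule ℝ R) (n : ℤ) : Submodule ℝ (DS σ) where
  carrier := {x | x.1 ∈ 𝒜 n ∧ x.2 ∈ 𝒜 (n - 1)}
  add_mem' := fun hx hy => ⟨add_mem hx.1 hy.1, add_mem hx.2 hy.2⟩
  zero_mem' := ⟨zero_mem _, zero_mem _⟩
  smul_mem' := fun c _ hx => ⟨Submodule.smul_mem _ c hx.1, Submodule.smul_mem _ c hx.2⟩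

/-- build a linear map on `R ⊕ ds R` -/
def DS.mk (σ : R →ₐ[ℝ] R) (f g h : R →ₗ[ℝ] R) : DS σ →ₗ[ℝ] DS σ where
  toFun x := DS.of σ (f x.1) (g x.1 + h x.2)
  map_add' x y := by
    ext
    · simp
    · simp; abel
  map_smul' c x := by ext <;> simp

@[simp] lemma DS.mk_fst (f g h : R →ₗ[ℝ] R) (x : DS σ) : (DS.mk σ f g h x).1 = f x.1 := rfl
@[simp] lemma DS.mk_snd (f g h : R →ₗ[ℝ] R) (x : DS σ) :
    (DS.mk σ f g h x).2 = g x.1 + h x.2 := rfl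

variable {𝒜 : ℤ → Submodule ℝ R}

lemma DS.internal (hA : DirectSum.IsInternal 𝒜) : DirectSum.IsInternal (DS.gr σ 𝒜) := by
  refine internal_of_proj ?_ ?_
  · intro n
    obtain ⟨p, hp⟩ := exists_piecewise hA (fun i => if i = n then 1 else 0)
    obtain ⟨q, hq⟩ := exists_piecewise hA (fun i => if i = n - 1 then 1 else 0)
    refine ⟨DS.mk σ p 0 q, ?_, ?_⟩
    · intro x hx
      ext
      · simp [hp _ _ hx.1]
      · simp [hq _ _ hx.2]
    · intro m hm x hx
      ext
      · simp [hp _ _ hx.1, hm]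
      · simp [hq _ _ hx.2, hm]
  · rw [eq_top_iff]
    rintro x -
    have h1 : ∀ p : R, DS.of σ p 0 ∈ (iSup (DS.gr σ 𝒜)) := by
      intro p
      induction p using hom_ind hA with
      | h0 => exact zero_mem _
      | hadd x y hx hy =>
        convert add_mem hx hy using 1
        ext <;> simp
      | hh i a ha => exact Submodule.mem_iSup_of_mem i ⟨ha, zero_mem _⟩
    have h2 : ∀ p : R, DS.of σ 0 p ∈ (iSup (DS.gr σ 𝒜)) := by
      intro p
      induction p using hom_ind hA with
      | h0 => exact zero_mem _
      | hadd x y hx hy =>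
        convert add_mem hx hy using 1
        ext <;> simp
      | hh i a ha => exact Submodule.mem_iSup_of_mem (i + 1) ⟨zero_mem _, by simpa using ha⟩
    convert add_mem (h1 x.1) (h2 x.2) using 1
    ext <;> simp

lemma DS.gradedComm (hA : IsGradedComm 𝒜)
    (hσ : ∀ i, ∀ a ∈ 𝒜 i, σ a = (i.negOnePow : ℤ) • a) : IsGradedComm (DS.gr σ 𝒜) := by
  refine ⟨DS.internal hA.1, ⟨hA.2.1, zero_mem _⟩, ?_, ?_⟩
  · rintro i j a ⟨ha1, ha2⟩ b ⟨hb1, hb2⟩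
    refine ⟨hA.2.2.1 _ _ _ ha1 _ hb1, ?_⟩
    rw [DS.mul_snd, hσ _ _ ha1, smul_mul_assoc]
    refine add_mem ?_ (zsmul_mem ?_ _)
    · convert hA.2.2.1 _ _ _ ha2 _ hb1 using 2; ring
    · convert hA.2.2.1 _ _ _ ha1 _ hb2 using 2; ring
  · rintro i j a ⟨ha1, ha2⟩ b ⟨hb1, hb2⟩
    have c1 := hA.2.2.2 _ _ _ ha1 _ hb1
    have c2 := hA.2.2.2 _ _ _ ha2 _ hb1
    have c3 := hA.2.2.2 _ _ _ ha1 _ hb2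
    have s1 := hσ _ _ ha1
    have s2 := hσ _ _ hb1
    have e1 : ¬ Even (1 : ℤ) := by decide
    ext
    · exact c1
    · simp only [mul_snd, zsmul_snd, s1, s2, smul_mul_assoc, c2, c3]
      simp only [sg_ite, Int.even_sub, Int.even_mul, e1]
      by_cases hi : Even i <;> by_cases hj : Even j <;> simp [hi, hj] <;> abel

/-- data needed on `R = A[s]` -/
structure PathData (𝒜 : ℤ → Submodule ℝ R) (d D l f : R →ₗ[ℝ] R) : Prop where
  hA : IsGradedComm 𝒜
  hddeg : HasDeg 𝒜 d 1
  hder : IsGDer 𝒜 1 d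
  hd2 : ∀ x, d (d x) = 0
  hDdeg : ∀ i, ∀ a ∈ 𝒜 i, D a ∈ 𝒜 i
  hDder : ∀ a b, D (a * b) = D a * b + a * D b
  hdD : ∀ x, d (D x) = D (d x)
  hl : HasDeg 𝒜 l (-1)
  hlT : T3 𝒜 (-1) l
  hl2 : ∀ x, l (l x) = 0
  hdl : ∀ x, d (l x) = - l (d x)
  hf : HasDeg 𝒜 f (-2)
  hfT : T3 𝒜 (-2) f
  hlf : ∀ x, l (f x) = f (l x)
  hDl : ∀ x, D (l x) = l (D x) + f (d x) - d (f x)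

lemma DS.bv {d D l f : R →ₗ[ℝ] R} (h : PathData 𝒜 d D l f)
    (hσ : ∀ i, ∀ a ∈ 𝒜 i, σ a = (i.negOnePow : ℤ) • a) :
    BV (DS.gr σ 𝒜) (DS.mk σ d D (-d)) (DS.mk σ l (-f) (-l)) where
  hA := DS.gradedComm h.hA hσ
  hddeg := by
    rintro i x ⟨h1, h2⟩
    refine ⟨h.hddeg _ _ h1, add_mem ?_ (neg_mem ?_)⟩
    · convert h.hDdeg _ _ h1 using 2; ring
    · convert h.hddeg _ _ h2 using 2; ring
  hder := by
    rintro i a ⟨h1, h2⟩ b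
    have d1 := h.hder _ _ h1
    have d2 := h.hder _ _ h2
    have s1 := hσ _ _ h1
    have s2 := hσ _ _ (h.hddeg _ _ h1)
    have e1 : ¬ Even (1 : ℤ) := by decide
    simp only [sg_ite, Int.even_sub, Int.even_add, Int.even_mul, e1] at *
    by_cases hi : Even i <;>
      simp only [hi, iff_true, iff_false, true_or, or_true, or_false, false_or, true_iff,
      false_iff, not_true, not_false_iff, if_true, if_false, one_smul, neg_smul] at * <;>
      ext <;> simp [s1, s2, d1, d2, h.hDder] <;> noncomm_ring
  hd2 := by
    ext x
    · simp [h.hd2]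
    · simp [h.hd2, h.hdD]
  hl := by
    rintro i x ⟨h1, h2⟩
    refine ⟨h.hl _ _ h1, add_mem (neg_mem ?_) (neg_mem ?_)⟩
    · convert h.hf _ _ h1 using 2; ring
    · convert h.hl _ _ h2 using 2; ring
  hT := by
    rintro i j a ⟨ha1, ha2⟩ b ⟨hb1, hb2⟩ c
    have t0 := h.hlT _ _ _ ha1 _ hb1 c.1
    have t1 := h.hfT _ _ _ ha1 _ hb1 c.1
    have t2 := h.hlT _ _ _ ha2 _ hb1 c.1
    have t3 := h.hlT _ _ _ ha1 _ hb2 c.1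
    have t4 := h.hlT _ _ _ ha1 _ hb1 c.2
    have s1 := hσ _ _ ha1
    have s2 := hσ _ _ hb1
    have s3 := hσ _ _ (h.hl _ _ ha1)
    have s4 := hσ _ _ (h.hl _ _ hb1)
    have s5 := hσ _ _ (h.hl _ _ (h.hA.2.2.1 _ _ _ ha1 _ hb1))
    have e1 : ¬ Even (1 : ℤ) := by decide
    have e2 : Even (2 : ℤ) := by decide
    clear hσ h
    simp only [sg_ite, Int.even_sub, Int.even_add, Int.even_mul, even_neg, e1, e2] at *
    by_cases hi : Even i <;> by_cases hj : Even j <;>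
      simp only [hi, hj, iff_true, iff_false, true_or, or_true, or_false, false_or, true_iff,
      false_iff, not_true, not_false_iff, if_true, if_false, one_smul, neg_smul, mul_assoc] at * <;>
      ext <;> simp [s1, s2, s3, s4, s5, mul_assoc, t0, t1, t2, t3, t4, mul_add, add_mul] <;>
      noncomm_ring
  hl2 := by
    intro x
    ext
    · simp [h.hl2]
    · simp [h.hl2, h.hlf]
  hdl := by
    intro x
    ext
    · simp [h.hdl]
    · simp [h.hdl, h.hDl]; abel

end pair

section tensor

open scoped TensorProduct
open Polynomial

variable {A : Type} [Ring A] [Algebra ℝ A]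

/-- the grading on `A[s]` -/
noncomputable def tgr (𝒜 : ℤ → Submodule ℝ A) (n : ℤ) : Submodule ℝ (A ⊗[ℝ] ℝ[X]) :=
  LinearMap.range (LinearMap.rTensor ℝ[X] (𝒜 n).subtype)

lemma tmul_mem_tgr {𝒜 : ℤ → Submodule ℝ A} {n : ℤ} {a : A} (ha : a ∈ 𝒜 n) (p : ℝ[X]) :
    a ⊗ₜ[ℝ] p ∈ tgr 𝒜 n := ⟨⟨a, ha⟩ ⊗ₜ p, rfl⟩

lemma tgr_ind {𝒜 : ℤ → Submodule ℝ A} {n : ℤ} {P : A ⊗[ℝ] ℝ[X] → Prop}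
    (h0 : P 0) (hadd : ∀ x y, P x → P y → P (x + y))
    (hh : ∀ a ∈ 𝒜 n, ∀ p : ℝ[X], P (a ⊗ₜ p)) {x : A ⊗[ℝ] ℝ[X]} (hx : x ∈ tgr 𝒜 n) : P x := by
  obtain ⟨y, rfl⟩ := hx
  induction y using TensorProduct.induction_on with
  | zero => simpa using h0
  | tmul a p => exact hh a a.2 p
  | add x y hx hy => rw [map_add]; exact hadd _ _ hx hy

lemma tgr_internal {𝒜 : ℤ → Submodule ℝ A} (h : DirectSum.IsInternal 𝒜) :
    DirectSum.IsInternal (tgr 𝒜) := by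
  refine internal_of_proj ?_ ?_
  · intro n
    obtain ⟨p, hp⟩ := exists_piecewise h (fun i => if i = n then 1 else 0)
    refine ⟨LinearMap.rTensor _ p, ?_, ?_⟩
    · intro x hx
      refine tgr_ind (P := fun x => LinearMap.rTensor _ p x = x) (by simp)
        (fun x y hx hy => by simp only [map_add, hx, hy]) ?_ hx
      intro a ha q
      simp [hp _ _ ha]
    · intro m hm x hx
      refine tgr_ind (P := fun x => LinearMap.rTensor _ p x = 0) (by simp)
        (fun x y hx hy => by simp only [map_add, hx, hy, add_zero]) ?_ hx
      intro a ha q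
      simp [hp _ _ ha, hm]
  · rw [eq_top_iff]
    rintro x -
    induction x using TensorProduct.induction_on with
    | zero => exact zero_mem _
    | tmul a p =>
      induction a using hom_ind h with
      | h0 => simp
      | hadd x y hx hy => rw [TensorProduct.add_tmul]; exact add_mem hx hy
      | hh i a ha => exact Submodule.mem_iSup_of_mem i (tmul_mem_tgr ha p)
    | add x y hx hy => exact add_mem hx hy

lemma tgr_comm {𝒜 : ℤ → Submodule ℝ A} (h : IsGradedComm 𝒜) : IsGradedComm (tgr 𝒜) := by
  refine ⟨tgr_internal h.1, tmul_mem_tgr h.2.1 1, ?_, ?_⟩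
  · intro i j a ha b hb
    refine tgr_ind (P := fun a => a * b ∈ tgr 𝒜 (i + j)) (by simp)
      (fun x y hx hy => by simp only [add_mul]; exact add_mem hx hy) ?_ ha
    intro a ha p
    refine tgr_ind (P := fun b => a ⊗ₜ p * b ∈ tgr 𝒜 (i + j)) (by simp)
      (fun x y hx hy => by simp only [mul_add]; exact add_mem hx hy) ?_ hb
    intro b hb q
    rw [Algebra.TensorProduct.tmul_mul_tmul]
    exact tmul_mem_tgr (h.2.2.1 _ _ _ ha _ hb) _
  · intro i j a ha b hb
    refine tgr_ind (P := fun a => a * b = ((i * j).negOnePow : ℤ) • (b * a)) (by simp)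
      (fun x y hx hy => by simp only [add_mul, mul_add, hx, hy, smul_add]) ?_ ha
    intro a ha p
    refine tgr_ind (P := fun b => a ⊗ₜ p * b = ((i * j).negOnePow : ℤ) • (b * a ⊗ₜ p)) (by simp)
      (fun x y hx hy => by simp only [add_mul, mul_add, hx, hy, smul_add]) ?_ hb
    intro b hb q
    rw [Algebra.TensorProduct.tmul_mul_tmul, Algebra.TensorProduct.tmul_mul_tmul,
      h.2.2.2 _ _ _ ha _ hb, mul_comm q p, TensorProduct.smul_tmul']

/-- `a ⊗ p ↦ f a ⊗ m p` -/
noncomputable def top (f : A →ₗ[ℝ] A) (m : ℝ[X]) : A ⊗[ℝ] ℝ[X] →ₗ[ℝ] A ⊗[ℝ] ℝ[X] :=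
  TensorProduct.map f (LinearMap.mulLeft ℝ m)

@[simp] lemma top_tmul (f : A →ₗ[ℝ] A) (m : ℝ[X]) (a : A) (p : ℝ[X]) :
    top f m (a ⊗ₜ p) = f a ⊗ₜ (m * p) := by simp [top]

/-- `d/ds` -/
noncomputable def tD : A ⊗[ℝ] ℝ[X] →ₗ[ℝ] A ⊗[ℝ] ℝ[X] :=
  LinearMap.lTensor A (derivative : ℝ[X] →ₗ[ℝ] ℝ[X])

@[simp] lemma tD_tmul (a : A) (p : ℝ[X]) :
    tD (a ⊗ₜ[ℝ] p) = a ⊗ₜ (derivative p) := by simp [tD]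

lemma top_deg {𝒜 : ℤ → Submodule ℝ A} {f : A →ₗ[ℝ] A} {r : ℤ} (h : HasDeg 𝒜 f r) (m : ℝ[X]) :
    HasDeg (tgr 𝒜) (top f m) r := by
  intro i a ha
  refine tgr_ind (P := fun a => top f m a ∈ tgr 𝒜 (i + r)) (by simp)
    (fun x y hx hy => by simp only [map_add]; exact add_mem hx hy) ?_ ha
  intro a ha p
  rw [top_tmul]
  exact tmul_mem_tgr (h _ _ ha) _

lemma top_der {𝒜 : ℤ → Submodule ℝ A} {f : A →ₗ[ℝ] A} {r : ℤ} (h : IsGDer 𝒜 r f) :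
    IsGDer (tgr 𝒜) r (top f 1) := by
  intro i a ha b
  refine tgr_ind (P := fun a => top f 1 (a * b) = top f 1 a * b
    + ((r * i).negOnePow : ℤ) • (a * top f 1 b)) (by simp)
    (fun x y hx hy => by simp only [map_add, add_mul, hx, hy, smul_add]; abel) ?_ ha
  intro a ha p
  induction b using TensorProduct.induction_on with
  | zero => simp
  | tmul b q =>
    simp only [Algebra.TensorProduct.tmul_mul_tmul, top_tmul, h _ _ ha, one_mul,
      TensorProduct.add_tmul, TensorProduct.smul_tmul']
  | add x y hx hy => simp only [map_add, mul_add, hx, hy, smul_add]; abel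

lemma top_T3 {𝒜 : ℤ → Submodule ℝ A} {f : A →ₗ[ℝ] A} {r : ℤ} (h : T3 𝒜 r f) (m : ℝ[X]) :
    T3 (tgr 𝒜) r (top f m) := by
  intro i j a ha b hb c
  refine tgr_ind (P := fun a => top f m (a * b * c)
      = ((r * i).negOnePow : ℤ) • (a * top f m (b * c))
      + (((r + i) * j).negOnePow : ℤ) • (b * top f m (a * c))
      - ((r * (i + j)).negOnePow : ℤ) • (a * b * top f m c)
      + top f m (a * b) * c - ((r * i).negOnePow : ℤ) • (a * top f m b * c)
      - top f m a * b * c) (by simp)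
    (fun x y hx hy => by simp only [map_add, add_mul, mul_add, hx, hy, smul_add]; abel) ?_ ha
  intro a ha p
  refine tgr_ind (P := fun b => top f m (a ⊗ₜ p * b * c)
      = ((r * i).negOnePow : ℤ) • (a ⊗ₜ p * top f m (b * c))
      + (((r + i) * j).negOnePow : ℤ) • (b * top f m (a ⊗ₜ p * c))
      - ((r * (i + j)).negOnePow : ℤ) • (a ⊗ₜ p * b * top f m c)
      + top f m (a ⊗ₜ p * b) * c - ((r * i).negOnePow : ℤ) • (a ⊗ₜ p * top f m b * c)
      - top f m (a ⊗ₜ p) * b * c) (by simp)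
    (fun x y hx hy => by simp only [map_add, add_mul, mul_add, hx, hy, smul_add]; abel) ?_ hb
  intro b hb q
  induction c using TensorProduct.induction_on with
  | zero => simp
  | tmul c u =>
    have e1 : p * (m * (q * u)) = m * (p * q * u) := by ring
    have e2 : q * (m * (p * u)) = m * (p * q * u) := by ring
    have e3 : p * q * (m * u) = m * (p * q * u) := by ring
    have e4 : m * (p * q) * u = m * (p * q * u) := by ring
    have e5 : p * (m * q) * u = m * (p * q * u) := by ring
    have e6 : m * p * q * u = m * (p * q * u) := by ring
    simp only [Algebra.TensorProduct.tmul_mul_tmul, top_tmul, h _ _ _ ha _ hb, e1, e2, e3, e4, e5,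
      e6, TensorProduct.add_tmul, TensorProduct.sub_tmul, TensorProduct.smul_tmul']
  | add x y hx hy => simp only [map_add, mul_add, hx, hy, smul_add]; abel

lemma lin_ext {M : Type} [AddCommGroup M] [Module ℝ M] {f g : A ⊗[ℝ] ℝ[X] →ₗ[ℝ] M}
    (h : ∀ a p, f (a ⊗ₜ p) = g (a ⊗ₜ p)) (x : A ⊗[ℝ] ℝ[X]) : f x = g x := by
  rw [TensorProduct.ext' h]

lemma path {𝒜 : ℤ → Submodule ℝ A} {d l f : A →ₗ[ℝ] A} (h : BV 𝒜 d l)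
    (hf : HasDeg 𝒜 f (-2)) (hfT : T3 𝒜 (-2) f) (hl : ∀ x, l x = f (d x) - d (f x))
    (hlf : ∀ x, l (f x) = f (l x)) :
    PathData (tgr 𝒜) (top d 1) tD (top l X) (top f 1) where
  hA := tgr_comm h.hA
  hddeg := top_deg h.hddeg 1
  hder := top_der h.hder
  hd2 := lin_ext (f := top d 1 ∘ₗ top d 1) (g := 0) (fun a p => by
    have : d (d a) = 0 := LinearMap.congr_fun h.hd2 a
    simp [this])
  hDdeg := by
    intro i a ha
    refine tgr_ind (P := fun a => tD a ∈ tgr 𝒜 i) (by simp)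
      (fun x y hx hy => by simp only [map_add]; exact add_mem hx hy) ?_ ha
    intro a ha p
    rw [tD_tmul]
    exact tmul_mem_tgr ha _
  hDder := by
    intro a b
    induction a using TensorProduct.induction_on with
    | zero => simp
    | add x y hx hy => simp only [map_add, add_mul, hx, hy]; abel
    | tmul a p =>
      induction b using TensorProduct.induction_on with
      | zero => simp
      | add x y hx hy => simp only [map_add, mul_add, hx, hy]; abel
      | tmul b q =>
        simp only [Algebra.TensorProduct.tmul_mul_tmul, tD_tmul, derivative_mul,
          TensorProduct.tmul_add]
  hdD := lin_ext (f := top d 1 ∘ₗ tD) (g := tD ∘ₗ top d 1) (fun a p => by simp)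
  hl := top_deg h.hl X
  hlT := top_T3 h.hT X
  hl2 := lin_ext (f := top l X ∘ₗ top l X) (g := 0) (fun a p => by simp [h.hl2])
  hdl := lin_ext (f := top d 1 ∘ₗ top l X) (g := - (top l X ∘ₗ top d 1)) (fun a p => by
    simp [h.hdl, TensorProduct.neg_tmul])
  hf := top_deg hf 1
  hfT := top_T3 hfT 1
  hlf := lin_ext (f := top l X ∘ₗ top f 1) (g := top f 1 ∘ₗ top l X) (fun a p => by
    simp [hlf])
  hDl := lin_ext (f := tD ∘ₗ top l X) (g := top l X ∘ₗ tD + top f 1 ∘ₗ top d 1 - top d 1 ∘ₗ top f 1)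
    (fun a p => by
      simp only [LinearMap.comp_apply, LinearMap.add_apply, LinearMap.sub_apply, top_tmul, tD_tmul,
        derivative_mul, derivative_X, one_mul, TensorProduct.tmul_add]
      rw [hl a, TensorProduct.sub_tmul, TensorProduct.sub_tmul]
      abel)

/-- evaluation at `s = c` -/
noncomputable def ev (c : ℝ) : A ⊗[ℝ] ℝ[X] →ₐ[ℝ] A :=
  (Algebra.TensorProduct.rid ℝ ℝ A).toAlgHom.comp
    (Algebra.TensorProduct.map (AlgHom.id ℝ A) (Polynomial.aeval c))

@[simp] lemma ev_tmul (c : ℝ) (a : A) (p : ℝ[X]) : ev c (a ⊗ₜ[ℝ] p) = p.eval c • a := by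
  simp [ev, Polynomial.aeval_def, Polynomial.eval₂_eq_eval_map]

lemma exists_antider (c : ℝ) : ∃ h : ℝ[X] →ₗ[ℝ] ℝ[X],
    (∀ p, derivative (h p) = p) ∧ ∀ p, h (derivative p) = p - C (p.eval c) := by
  have hs : Function.Surjective (derivative : ℝ[X] →ₗ[ℝ] ℝ[X]) := by
    intro p
    induction p using Polynomial.induction_on' with
    | add p q hp hq =>
      obtain ⟨a, rfl⟩ := hp
      obtain ⟨b, rfl⟩ := hq
      exact ⟨a + b, map_add _ _ _⟩
    | monomial n a =>
      refine ⟨monomial (n + 1) (a / (n + 1)), ?_⟩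
      rw [derivative_monomial]
      have : (n : ℝ) + 1 ≠ 0 := by positivity
      simp [this]
  obtain ⟨g, hg⟩ := LinearMap.exists_rightInverse_of_surjective _ (LinearMap.range_eq_top.mpr hs)
  have hg' : ∀ p, derivative (g p) = p := fun p => LinearMap.congr_fun hg p
  refine ⟨g - (Algebra.linearMap ℝ ℝ[X]) ∘ₗ (Polynomial.leval c) ∘ₗ g, ?_, ?_⟩
  · intro p; simp [hg', Polynomial.algebraMap_eq]
  · intro p
    have h0 : derivative (g (derivative p) - p) = 0 := by
      rw [derivative_sub, hg', sub_self]
    have h1 := Polynomial.eq_C_of_natDegree_eq_zero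
      (Polynomial.derivative_eq_zero.mp h0)
    have h2 := congrArg (Polynomial.eval c) h1
    rw [eval_C] at h2
    rw [← h2, eval_sub, C_sub] at h1
    simp only [LinearMap.sub_apply, LinearMap.comp_apply, Algebra.linearMap_apply, leval_apply,
      Polynomial.algebraMap_eq]
    linear_combination h1

lemma exists_H (c : ℝ) : ∃ H : A ⊗[ℝ] ℝ[X] →ₗ[ℝ] A ⊗[ℝ] ℝ[X],
    (∀ x, tD (H x) = x) ∧ (∀ x, H (tD x) = x - (ev c x) ⊗ₜ 1) ∧
    (∀ (f : A →ₗ[ℝ] A) x, H (top f 1 x) = top f 1 (H x)) := by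
  obtain ⟨h, h1, h2⟩ := exists_antider c
  refine ⟨LinearMap.lTensor A h, ?_, ?_, ?_⟩
  · exact lin_ext (f := tD ∘ₗ LinearMap.lTensor A h) (g := LinearMap.id)
      (fun a p => by simp [h1])
  · intro x
    induction x using TensorProduct.induction_on with
    | zero => simp
    | add x y hx hy => simp only [map_add, hx, hy, TensorProduct.add_tmul]; abel
    | tmul a p =>
      rw [tD_tmul, LinearMap.lTensor_tmul, h2, ev_tmul, TensorProduct.tmul_sub,
        TensorProduct.smul_tmul, Polynomial.smul_eq_C_mul, mul_one]
  · intro f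
    exact lin_ext (f := LinearMap.lTensor A h ∘ₗ top f 1) (g := top f 1 ∘ₗ LinearMap.lTensor A h)
      (fun a p => by simp)

/-- evaluation `A[s] ⊕ ds A[s] → A` at `s = c`. -/
noncomputable def evB (σ : A ⊗[ℝ] ℝ[X] →ₐ[ℝ] A ⊗[ℝ] ℝ[X]) (c : ℝ) : DS σ →ₐ[ℝ] A :=
  AlgHom.ofLinearMap
    { toFun := fun x => ev c x.1
      map_add' := fun x y => by simp
      map_smul' := fun r x => by simp }
    (by simp) (fun x y => by simp)

@[simp] lemma evB_apply (σ : A ⊗[ℝ] ℝ[X] →ₐ[ℝ] A ⊗[ℝ] ℝ[X]) (c : ℝ) (x : DS σ) :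
    evB σ c x = ev c x.1 := rfl

lemma ev_top (c : ℝ) (f : A →ₗ[ℝ] A) (m : ℝ[X]) (x : A ⊗[ℝ] ℝ[X]) :
    ev c (top f m x) = m.eval c • f (ev c x) := by
  refine lin_ext (f := (ev c).toLinearMap ∘ₗ top f m)
    (g := m.eval c • (f ∘ₗ (ev c).toLinearMap)) (fun a p => ?_) x
  simp [mul_smul]

lemma exists_evhom {𝒜 : ℤ → Submodule ℝ A} {d l f : A →ₗ[ℝ] A} (h : BV 𝒜 d l)
    (σ : A ⊗[ℝ] ℝ[X] →ₐ[ℝ] A ⊗[ℝ] ℝ[X])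
    (hσ : ∀ i, ∀ a ∈ tgr 𝒜 i, σ a = (i.negOnePow : ℤ) • a) (c : ℝ)
    (S : DGLAon ℝ A) (hS : S.grading = (fun n => 𝒜 (n + 1)) ∧ S.d = d ∧
      (∀ i : ℤ, ∀ a ∈ 𝒜 i, ∀ b : A, S.bracket a b = koszulBr (c • l) i a b))
    (SB : DGLAon ℝ (DS σ)) (hSB : SB.grading = (fun n => DS.gr σ (tgr 𝒜) (n + 1)) ∧
      SB.d = DS.mk σ (top d 1) tD (-top d 1) ∧
      (∀ i : ℤ, ∀ a ∈ DS.gr σ (tgr 𝒜) i, ∀ b, SB.bracket a b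
        = koszulBr (DS.mk σ (top l X) (-top f 1) (-top l X)) i a b)) :
    ∃ φ : DGLAHom ℝ ⟨DS σ, SB⟩ ⟨A, S⟩, IsQuasiIso ℝ φ := by
  refine exists_hom (DS.gradedComm (tgr_comm h.hA) hσ) S hS SB hSB (evB σ c) ?_ ?_ ?_ ?_ ?_
  · rintro i x ⟨hx, -⟩
    rw [evB_apply]
    refine tgr_ind (P := fun a => ev c a ∈ 𝒜 i) (by simp)
      (fun x y hx hy => by simp only [map_add]; exact add_mem hx hy) ?_ hx
    intro a ha p
    rw [ev_tmul]
    exact Submodule.smul_mem _ _ ha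
  · intro x; simp [ev_top]
  · intro x; simp [ev_top]
  · rintro x hx ⟨z, hz⟩
    obtain ⟨H, H1, H2, H3⟩ := exists_H (A := A) c
    have x1 : top d 1 x.1 = 0 := congrArg Prod.fst hx
    have x2 : tD x.1 + (-top d 1) x.2 = 0 := congrArg Prod.snd hx
    have x3 : top d 1 x.2 = tD x.1 := by
      rw [LinearMap.neg_apply] at x2
      exact (add_neg_eq_zero.mp x2).symm
    rw [evB_apply] at hz
    refine ⟨DS.of σ (H x.2 + z ⊗ₜ 1) 0, ?_⟩
    ext
    · rw [DS.mk_fst, DS.of_fst, map_add, ← H3, x3, H2, hz]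
      simp
    · simp [H1]
  · intro y hy
    refine ⟨DS.of σ (y ⊗ₜ 1) 0, ?_, ?_⟩
    · ext <;> simp [hy]
    · simp

end tensor

end KoszulFormality

/-- For a Poisson bivector `π` on a smooth manifold `X`, the shifted de Rham
complex `(A_X[1], d, [,]_π)` with the Koszul bracket is a homotopy abelian DGLA (hence formal,
the Koszul bracket being trivial in de Rham cohomology). -/
theorem koszul_bracket_deRham_formality
    {A : Type} [Ring A] [Algebra ℝ A]
    (𝒜 : ℤ → Submodule ℝ A) (hA : IsGradedComm 𝒜)
    (d : A →ₗ[ℝ] A) (hddeg : HasDeg 𝒜 d 1) (hder : IsGDer 𝒜 1 d) (hd2 : d ∘ₗ d = 0)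
    (iπ : A →ₗ[ℝ] A)
    -- the interior product by a bivector field is a second-order operator of degree `-2`
    -- annihilating `1`:
    (hiπ : IsQuasiBV 𝒜 (-2) iπ)
    -- the Poisson condition `[π,π]_SN = 0`, via Cartan's formula `[l_π,i_π] = i_{[π,π]}`:
    (lπ : A →ₗ[ℝ] A) (hlπ : lπ = iπ ∘ₗ d - d ∘ₗ iπ)
    (hPoisson : lπ ∘ₗ iπ - iπ ∘ₗ lπ = 0) :
    ∃ S : DGLAon ℝ A,
      S.grading = (fun n => 𝒜 (n + 1)) ∧
      S.d = d ∧
      (∀ i : ℤ, ∀ a ∈ 𝒜 i, ∀ b : A, S.bracket a b = koszulBr lπ i a b) ∧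
      HomotopyAbelian ℝ ⟨A, S⟩ := by

  have hl' : ∀ x, lπ x = iπ (d x) - d (iπ x) := fun x => by simp [hlπ]
  have hd2' : ∀ x, d (d x) = 0 := fun x => LinearMap.congr_fun hd2 x
  have hcomm : ∀ x, lπ (iπ x) = iπ (lπ x) := fun x =>
    sub_eq_zero.mp (LinearMap.congr_fun hPoisson x)
  have hdl : ∀ x, d (lπ x) = - lπ (d x) := fun x => by simp [hl', hd2']
  have hT := KoszulFormality.T3_of_diff hA hiπ
  have hdeg : HasDeg 𝒜 lπ (-1) := by
    intro i a ha
    rw [hl']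
    refine sub_mem ?_ ?_
    · convert hiπ.1 _ _ (hddeg _ _ ha) using 2; ring
    · convert hddeg _ _ (hiπ.1 _ _ ha) using 2; ring
  have hbv : KoszulFormality.BV 𝒜 d lπ :=
    { hA := hA, hddeg := hddeg, hder := hder, hd2 := hd2, hl := hdeg
      hT := KoszulFormality.T3_comm hA d hddeg hder iπ lπ hiπ.1 hT hl'
      hl2 := fun x => by
        have h1 : lπ (lπ x) = iπ (d (lπ x)) - d (iπ (lπ x)) := hl' _
        have h2 : d (lπ (iπ x)) = - lπ (d (iπ x)) := hdl _
        have h3 : lπ (lπ x) = lπ (iπ (d x)) - lπ (d (iπ x)) := by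
          conv_lhs => rw [hl' x, map_sub]
        rw [hdl, map_neg, ← hcomm, ← hcomm, h2] at h1
        have h4 : (2 : ℝ) • lπ (lπ x) = 0 := by
          rw [two_smul]
          nth_rewrite 1 [h1]
          rw [h3]; abel
        simpa using h4
      hdl := hdl }
  have hbv0 : KoszulFormality.BV 𝒜 d ((0 : ℝ) • lπ) :=
    { hA := hA, hddeg := hddeg, hder := hder, hd2 := hd2
      hl := fun i a ha => by simp
      hT := fun i j a ha b hb c => by simp
      hl2 := fun x => by simp
      hdl := fun x => by simp }
  obtain ⟨S, hS⟩ := KoszulFormality.exists_dgla hbv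
  obtain ⟨S0, hS0⟩ := KoszulFormality.exists_dgla hbv0
  have hP := KoszulFormality.path hbv hiπ.1 hT hl' hcomm
  obtain ⟨σ, hσ⟩ := KoszulFormality.exists_sigma hP.hA
  obtain ⟨SB, hSB⟩ := KoszulFormality.exists_dgla (KoszulFormality.DS.bv hP hσ)
  refine ⟨S, hS.1, hS.2.1, hS.2.2, ⟨A, S0⟩, ?_, ?_⟩
  · intro x y
    change S0.bracket x y = 0
    induction x using KoszulFormality.hom_ind hA.1 with
    | h0 => simp
    | hadd x y hx hy => simp only [map_add, LinearMap.add_apply, hx, hy, add_zero]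
    | hh i a ha =>
      rw [hS0.2.2 _ _ ha]
      simp [koszulBr]
  · refine Relation.EqvGen.trans _ ⟨KoszulFormality.DS σ, SB⟩ _ (Relation.EqvGen.symm _ _ ?_) ?_
    · refine Relation.EqvGen.rel _ _
        (KoszulFormality.exists_evhom hbv σ hσ 1 S (by simpa using hS) SB hSB)
    · exact Relation.EqvGen.rel _ _ (KoszulFormality.exists_evhom hbv σ hσ 0 S0 hS0 SB hSB)
end
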